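/- arXiv:2212.11243 — 3 statements merged into one kernel-verified Lean document; each statement's English description precedes it below -/
import Mathlib

section
/- Let n ≥ 3 and let 𝒮 be a finite set of trivalent trees with leaf set {1,…,n}. Then, summing over all (2,n) color orderings σ on {1,…,n}, one has Σ_σ #{T ∈ 𝒮 : T is compatible with σ} = 2^{n−3} · |𝒮|; more generally, for any function F : 𝒮 → ℝ, Σ_σ Σ_{T ∈ 𝒮, T compatible with σ} F(T) = 2^{n−3} · Σ_{T ∈ 𝒮} F(T). (This is the combinatorial content of the Dolan–Goddard relation expressing the single-scalar φ³ amplitude as 2^{−(n−3)} times the sum over all color orderings of the diagonal partial amplitudes.) -/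
open scoped Classical

/-- Dihedral equivalence of lists: `l₂` is obtained from `l₁` by a rotation,
possibly composed with a reversal. -/
def DihEquiv {α : Type*} (l₁ l₂ : List α) : Prop :=
  List.IsRotated l₁ l₂ ∨ List.IsRotated l₁.reverse l₂

theorem dihEquiv_refl {α : Type*} (l : List α) : DihEquiv l l :=
  Or.inl (List.IsRotated.refl l)

theorem dihEquiv_symm {α : Type*} {l₁ l₂ : List α} (h : DihEquiv l₁ l₂) : DihEquiv l₂ l₁ := by
  rcases h with h | h
  · exact Or.inl h.symm
  · have h2 := h.reverse
    rw [List.reverse_reverse] at h2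
    exact Or.inr h2.symm

theorem dihEquiv_trans {α : Type*} {l₁ l₂ l₃ : List α} (h : DihEquiv l₁ l₂)
    (h' : DihEquiv l₂ l₃) : DihEquiv l₁ l₃ := by
  rcases h with h | h <;> rcases h' with h' | h'
  · exact Or.inl (h.trans h')
  · exact Or.inr (h.reverse.trans h')
  · exact Or.inr (h.trans h')
  · have h2 := h.reverse
    rw [List.reverse_reverse] at h2
    exact Or.inl (h2.trans h')

/-- The setoid whose quotient is the set of (2,m) color orderings represented by
cyclic words satisfying `P`. -/
def wordSetoid {α : Type*} (P : List α → Prop) : Setoid {l : List α // P l} where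
  r l₁ l₂ := DihEquiv l₁.1 l₂.1
  iseqv := ⟨fun l => dihEquiv_refl l.1, dihEquiv_symm, dihEquiv_trans⟩

/-- The type of (2, `L.card`) color orderings on the label set `L`. -/
def ColorOrderingOn {α : Type*} [DecidableEq α] (L : Finset α) :=
  Quotient (wordSetoid (fun l : List α => l.Nodup ∧ l.toFinset = L))

noncomputable section

/-- `G` is a trivalent tree whose set of leaves (degree-1 vertices) is exactly `L`,
all other vertices being internal of degree 3. -/
def IsTrivalentTree {V : Type*} [Fintype V] (G : SimpleGraph V) (L : Finset V) : Prop :=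
  G.IsTree ∧ (∀ v : V, v ∈ L ↔ G.degree v = 1) ∧ ∀ v : V, v ∉ L → G.degree v = 3

/-- The block of the leaf partition induced by deleting the edge `{u,v}` of `G`:
the leaves in `L` lying on the `u`-side. -/
def leafSide {V : Type*} [Fintype V] [DecidableEq V] (G : SimpleGraph V) (L : Finset V)
    (u v : V) : Finset V :=
  L.filter (fun x => (G.deleteEdges {s(u, v)}).Reachable u x)

/-- The labels in `B` occupy a contiguous arc of the cyclic word `l`. -/
def IsArc {α : Type*} [DecidableEq α] (l : List α) (B : Finset α) : Prop :=
  ∃ m k : ℕ, ((l.rotate m).take k).toFinset = B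

/-- The cyclic word `l` is compatible with (planar with respect to) the tree `G` with
leaf set `L`. -/
def CompatTree {V : Type*} [Fintype V] [DecidableEq V] (G : SimpleGraph V) (L : Finset V)
    (l : List V) : Prop :=
  ∀ u v : V, G.Adj u v → IsArc l (leafSide G L u v)

/-- The tree `G` is compatible with the color ordering `w` on `L`. -/
def CompatQ {V : Type*} [Fintype V] [DecidableEq V] (G : SimpleGraph V) (L : Finset V)
    (w : ColorOrderingOn L) : Prop :=
  ∃ l : {l : List V // l.Nodup ∧ l.toFinset = L},
    Quotient.mk (wordSetoid _) l = w ∧ CompatTree G L l.1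

section Lists

variable {α : Type*}

theorem isRotated_iff_exists_append {l l' : List α} :
    l ~r l' ↔ ∃ p q, l = p ++ q ∧ l' = q ++ p := by
  constructor
  · intro h
    obtain ⟨n, hn, rfl⟩ := List.isRotated_iff_mod.1 h
    exact ⟨l.take n, l.drop n, (List.take_append_drop n l).symm,
      List.rotate_eq_drop_append_take hn⟩
  · rintro ⟨p, q, rfl, rfl⟩
    exact List.isRotated_append

theorem eq_of_cons_isRotated_cons {r : α} {a b : List α} (hr : r ∉ a)
    (h : (r :: a) ~r (r :: b)) : a = b := by
  obtain ⟨p, q, h₁, h₂⟩ := isRotated_iff_exists_append.1 h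
  rcases p with _ | ⟨x, p⟩
  · rw [List.nil_append] at h₁
    rw [List.append_nil, ← h₁] at h₂
    exact (List.cons.inj h₂).2.symm
  · rcases q with _ | ⟨y, q⟩
    · simp_all
    · simp only [List.cons_append, List.cons.injEq] at h₁ h₂
      obtain ⟨rfl, rfl⟩ := h₁
      obtain ⟨rfl, rfl⟩ := h₂
      simp at hr

theorem cons_dihEquiv_cons_iff {r : α} {a b : List α} (hr : r ∉ a) :
    DihEquiv (r :: a) (r :: b) ↔ b = a ∨ b = a.reverse := by
  have hrev : (r :: a).reverse ~r (r :: a.reverse) := by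
    rw [List.reverse_cons]
    exact List.isRotated_append
  constructor
  · rintro (h | h)
    · exact Or.inl (eq_of_cons_isRotated_cons hr h).symm
    · exact Or.inr (eq_of_cons_isRotated_cons (by simpa using hr) (hrev.symm.trans h)).symm
  · rintro (rfl | rfl)
    · exact dihEquiv_refl _
    · exact Or.inr hrev

theorem reverse_ne_self_of_nodup {l : List α} (hl : l.Nodup) (h2 : 2 ≤ l.length) :
    l.reverse ≠ l := by
  intro h
  have h0 : l[0]? = l[l.length - 1 - 0]? := by
    conv_lhs => rw [← h]
    exact List.getElem?_reverse (by omega)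
  rw [List.getElem?_eq_getElem (by omega), List.getElem?_eq_getElem (by omega),
    Option.some_inj, hl.getElem_inj_iff] at h0
  omega

variable [DecidableEq α]

theorem isArc_iff {l : List α} {B : Finset α} :
    IsArc l B ↔ ∃ p q, (p ++ q) ~r l ∧ p.toFinset = B := by
  constructor
  · rintro ⟨m, k, rfl⟩
    refine ⟨_, (l.rotate m).drop k, ?_, rfl⟩
    rw [List.take_append_drop]
    exact List.IsRotated.symm ⟨m, rfl⟩
  · rintro ⟨p, q, h, rfl⟩
    obtain ⟨m, hm⟩ := h.symm
    exact ⟨m, p.length, by simp [hm]⟩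

theorem IsArc.of_dihEquiv {l l' : List α} {B : Finset α} (h : DihEquiv l l') (hB : IsArc l B) :
    IsArc l' B := by
  rw [isArc_iff] at hB ⊢
  obtain ⟨p, q, hpq, rfl⟩ := hB
  rcases h with h | h
  · exact ⟨p, q, hpq.trans h, rfl⟩
  · refine ⟨p.reverse, q.reverse, ?_, by simp⟩
    have := hpq.reverse
    rw [List.reverse_append] at this
    exact (List.isRotated_append.trans this).trans h

theorem IsArc.compl {l : List α} {B : Finset α} (hl : l.Nodup) (hB : IsArc l B) :
    IsArc l (l.toFinset \ B) := by
  rw [isArc_iff] at hB ⊢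
  obtain ⟨p, q, hpq, rfl⟩ := hB
  refine ⟨q, p, List.isRotated_append.trans hpq, ?_⟩
  have hn := List.nodup_append.1 (hpq.nodup_iff.2 hl)
  ext x
  have hx : x ∈ p ++ q ↔ x ∈ l := hpq.mem_iff
  have := hn.2.2 x
  grind [List.mem_toFinset]

/-- The elements of `B` occupy a contiguous segment of the word `l`. -/
def IsSegment (l : List α) (B : Finset α) : Prop :=
  ∃ s, s <:+: l ∧ s.toFinset = B

theorem isArc_cons_iff {r : α} {l : List α} {B : Finset α} (hl : r ∉ l) (hB : r ∉ B) :
    IsArc (r :: l) B ↔ IsSegment l B := by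
  rw [isArc_iff]
  constructor
  · rintro ⟨p, q, h, rfl⟩
    have hr : r ∈ p ++ q := h.mem_iff.2 (by simp)
    have hq : r ∈ q := by simp_all
    obtain ⟨q₁, q₂, rfl⟩ := List.append_of_mem hq
    have h' : (r :: l) ~r (r :: (q₂ ++ p ++ q₁)) := by
      refine h.symm.trans (isRotated_iff_exists_append.2 ⟨p ++ q₁, r :: q₂, ?_, ?_⟩) <;> simp
    rw [eq_of_cons_isRotated_cons hl h']
    exact ⟨p, ⟨q₂, q₁, rfl⟩, rfl⟩
  · rintro ⟨s, ⟨x, y, rfl⟩, rfl⟩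
    exact ⟨s, y ++ r :: x,
      isRotated_iff_exists_append.2 ⟨s ++ y, r :: x, by simp, by simp⟩, rfl⟩

theorem IsSegment.reverse {l : List α} {B : Finset α} (h : IsSegment l B) :
    IsSegment l.reverse B := by
  obtain ⟨s, hs, rfl⟩ := h
  exact ⟨s.reverse, List.reverse_infix.2 hs, by simp⟩

theorem IsSegment.left_of_append {p q : List α} {B : Finset α} (hd : p.Disjoint q)
    (hB : B ⊆ p.toFinset) (h : IsSegment (p ++ q) B) : IsSegment p B := by
  obtain ⟨s, hs, rfl⟩ := h
  refine ⟨s, ?_, rfl⟩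
  have h' := hs.filter (fun x => decide (x ∈ p))
  have e₁ : s.filter (fun x => decide (x ∈ p)) = s := by
    rw [List.filter_eq_self]
    intro a ha
    simpa using hB (List.mem_toFinset.2 ha)
  have e₂ : (p ++ q).filter (fun x => decide (x ∈ p)) = p := by
    rw [List.filter_append, List.filter_eq_self.2 (by simp), List.filter_eq_nil_iff.2,
      List.append_nil]
    intro a ha
    simpa using fun h => hd h ha
  rwa [e₁, e₂] at h'

theorem IsSegment.append_right {p : List α} {B : Finset α} (h : IsSegment p B) (q : List α) :
    IsSegment (p ++ q) B := by
  obtain ⟨s, hs, rfl⟩ := h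
  exact ⟨s, hs.trans (List.prefix_append p q).isInfix, rfl⟩

theorem IsSegment.append_left {q : List α} {B : Finset α} (h : IsSegment q B) (p : List α) :
    IsSegment (p ++ q) B := by
  obtain ⟨s, hs, rfl⟩ := h
  exact ⟨s, hs.trans (List.suffix_append p q).isInfix, rfl⟩

theorem IsSegment.right_of_append {p q : List α} {B : Finset α} (hd : p.Disjoint q)
    (hB : B ⊆ q.toFinset) (h : IsSegment (p ++ q) B) : IsSegment q B := by
  have h' := h.reverse
  rw [List.reverse_append] at h'
  have := (IsSegment.left_of_append (by simpa using hd.symm) (by simpa using hB) h').reverse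
  simpa using this

theorem exists_append_of_isSegment {l : List α} {A B : Finset α} (hl : l.Nodup)
    (hAB : Disjoint A B) (hu : l.toFinset = A ∪ B) (hA : IsSegment l A) (hB : IsSegment l B) :
    ∃ p q, p.toFinset = A ∧ q.toFinset = B ∧ (l = p ++ q ∨ l = q ++ p) := by
  obtain ⟨s, ⟨x, y, h⟩, hs⟩ := hA
  obtain ⟨s', ⟨x', y', h'⟩, hs'⟩ := hB
  rw [Finset.disjoint_left] at hAB
  have key : ∀ {C D : Finset α} {p q : List α}, (∀ ⦃a⦄, a ∈ C → a ∉ D) → p ++ q = l →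
      l.toFinset = C ∪ D → p.toFinset = C → q.toFinset = D := by
    rintro C D p q hCD rfl hu rfl
    have hn := (List.nodup_append.1 hl).2.2
    ext a
    have := hn a
    have := @hCD a
    have := congrArg (a ∈ ·) hu
    grind [List.mem_toFinset]
  rcases x with _ | ⟨c, x⟩
  · exact ⟨s, y, hs, key hAB (by simpa using h) hu hs, Or.inl (by simpa using h.symm)⟩
  rcases x' with _ | ⟨c', x'⟩
  · refine ⟨y', s', key (fun a h₁ h₂ => hAB h₂ h₁) (by simpa using h')
      (by rw [hu, Finset.union_comm]) hs', hs', Or.inr (by simpa using h'.symm)⟩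
  exfalso
  subst h
  simp only [List.cons_append, List.cons.injEq] at h'
  obtain ⟨rfl, h'⟩ := h'
  have hc : c' ∈ A ∪ B := by rw [← hu]; simp
  subst hs hs'
  have h₁ : c' ∉ s := by simp_all
  have h₂ : c' ∉ s' := by
    have : (c' :: (x' ++ s' ++ y')).Nodup := by rw [h']; simpa using hl
    exact fun h => (List.nodup_cons.1 this).1 (by simp [h])
  simp_all

end Lists

section Trees

variable {V : Type*} {G : SimpleGraph V} {u v w x y a b : V}

/-- `x` lies on the `w`-side of the vertex `v`: it can be reached from `w` avoiding `v`. -/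
def Branch (G : SimpleGraph V) (v w x : V) : Prop :=
  ∃ p : G.Walk w x, p.IsPath ∧ v ∉ p.support

theorem Branch.of_walk (p : G.Walk w x) (hp : v ∉ p.support) : Branch G v w x := by
  classical
  exact ⟨p.bypass, p.bypass_isPath, fun h => hp (p.support_bypass_subset_support h)⟩

theorem Branch.ne (h : Branch G v w x) : x ≠ v := by
  rintro rfl
  obtain ⟨p, -, hp⟩ := h
  exact hp p.end_mem_support

theorem Branch.self (h : w ≠ v) : Branch G v w w :=
  Branch.of_walk SimpleGraph.Walk.nil (by simpa using h.symm)

theorem Branch.extend (h : Branch G v w x) (hxy : G.Adj x y) (hy : y ≠ v) : Branch G v w y := by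
  obtain ⟨p, -, hp⟩ := h
  refine Branch.of_walk (p.concat hxy) ?_
  simpa [SimpleGraph.Walk.support_concat, hp] using hy.symm

theorem SimpleGraph.IsTree.branch_or_branch (hG : G.IsTree) (h : G.Adj v w) (x : V) :
    Branch G v w x ∨ Branch G w v x := by
  classical
  obtain ⟨p, hp, -⟩ := hG.existsUnique_path w x
  by_cases hv : v ∈ p.support
  · right
    cases p with
    | nil => simp at hv; exact absurd hv h.ne
    | cons h' q =>
      rw [SimpleGraph.Walk.cons_isPath_iff] at hp
      have hvq : v ∈ q.support := by
        simpa [SimpleGraph.Walk.support_cons, h.ne] using hv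
      exact Branch.of_walk (q.dropUntil v hvq)
        fun hw => hp.2 (q.support_dropUntil_subset_support hvq hw)
  · exact Or.inl ⟨p, hp, hv⟩

theorem SimpleGraph.IsTree.not_branch_of_branch (hG : G.IsTree) (h : G.Adj v w)
    (h₁ : Branch G v w x) : ¬ Branch G w v x := by
  rintro ⟨q, hq, hwq⟩
  obtain ⟨p, hp, hvp⟩ := h₁
  have := (hG.existsUnique_path v x).unique hq
    ((SimpleGraph.Walk.cons_isPath_iff h p).2 ⟨hp, hvp⟩)
  subst this
  simp at hwq

theorem SimpleGraph.IsTree.branch_unique (hG : G.IsTree) (ha : G.Adj v a) (hb : G.Adj v b)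
    (h₁ : Branch G v a x) (h₂ : Branch G v b x) : a = b := by
  obtain ⟨p, hp, hvp⟩ := h₁
  obtain ⟨q, hq, hvq⟩ := h₂
  have := (hG.existsUnique_path v x).unique
    ((SimpleGraph.Walk.cons_isPath_iff ha p).2 ⟨hp, hvp⟩)
    ((SimpleGraph.Walk.cons_isPath_iff hb q).2 ⟨hq, hvq⟩)
  exact (SimpleGraph.Walk.cons.inj this).1

theorem Branch.exists_next (h : Branch G u v x) (hx : x ≠ v) :
    ∃ w, G.Adj v w ∧ w ≠ u ∧ Branch G v w x := by
  obtain ⟨p, hp, hu⟩ := h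
  cases p with
  | nil => exact absurd rfl hx
  | @cons _ w _ h' q =>
    rw [SimpleGraph.Walk.cons_isPath_iff] at hp
    refine ⟨w, h', ?_, q, hp⟩
    rintro rfl
    simp at hu

theorem SimpleGraph.IsTree.branch_of_next (hG : G.IsTree) (hu : G.Adj u v) (hw : G.Adj v w)
    (hne : w ≠ u) (h : Branch G v w x) : Branch G u v x :=
  (hG.branch_or_branch hu x).resolve_right
    fun h' => hne (hG.branch_unique hw hu.symm h h')

theorem SimpleGraph.IsTree.reachable_deleteEdges_iff_branch (hG : G.IsTree) (h : G.Adj u v) :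
    (G.deleteEdges {s(u, v)}).Reachable u x ↔ Branch G v u x := by
  have aux : ∀ {u v : V}, Branch G v u x → (G.deleteEdges {s(u, v)}).Reachable u x := by
    rintro u v ⟨p, -, hp⟩
    refine ⟨p.toDeleteEdge s(u, v) fun he => hp ?_⟩
    exact p.snd_mem_support_of_mem_edges he
  refine ⟨fun hr => (hG.branch_or_branch h.symm x).resolve_right fun h' => ?_, aux⟩
  have h₂ := aux h'
  rw [Sym2.eq_swap] at h₂
  have hb := SimpleGraph.isAcyclic_iff_forall_isBridge.1 hG.isAcyclic
    (SimpleGraph.mem_edgeSet G |>.2 h)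
  rw [SimpleGraph.isBridge_iff] at hb
  exact hb (hr.trans h₂.symm)

theorem SimpleGraph.IsTree.branch_of_leaf (hG : G.IsTree) (hu : G.Adj u v)
    (hN : ∀ w, G.Adj u w → w = v) (hx : x ≠ u) : Branch G u v x := by
  refine (hG.branch_or_branch hu x).resolve_right fun h => ?_
  obtain ⟨w, hw, hwv, -⟩ := h.exists_next hx
  exact hwv (hN w hw)

/-- The directed edge `x → y` points away from `u` and lies strictly beyond the directed
edge `u → v`. -/
def Beyond (G : SimpleGraph V) (u v x y : V) : Prop :=
  G.Adj x y ∧ Branch G u v x ∧ Branch G y x u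

theorem SimpleGraph.IsTree.beyond_of_next (hG : G.IsTree) (hu : G.Adj u v) (hw : G.Adj v w)
    (hne : w ≠ u) (h : Beyond G v w x y) : Beyond G u v x y := by
  obtain ⟨hxy, h₁, h₂⟩ := h
  have h₃ := hG.branch_of_next hu hw hne h₁
  refine ⟨hxy, h₃, h₂.extend hu.symm ?_⟩
  rintro rfl
  exact h₁.ne (hG.branch_unique hxy.symm hu (Branch.self hxy.ne) h₃)

theorem beyond_next (hu : G.Adj u v) (hw : G.Adj v w)
    (hne : w ≠ u) : Beyond G u v v w :=
  ⟨hw, Branch.self hu.ne', (Branch.self hw.ne).extend hu.symm hne.symm⟩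

theorem SimpleGraph.IsTree.exists_next_of_beyond (hG : G.IsTree) (hu : G.Adj u v)
    (h : Beyond G u v x y) :
    ∃ w, G.Adj v w ∧ w ≠ u ∧ (x = v ∧ y = w ∨ Beyond G v w x y) := by
  obtain ⟨hxy, h₁, h₂⟩ := h
  by_cases hx : x = v
  · subst hx
    exact ⟨y, hxy, h₂.ne.symm, Or.inl ⟨rfl, rfl⟩⟩
  · obtain ⟨w, hw, hne, h₃⟩ := h₁.exists_next hx
    refine ⟨w, hw, hne, Or.inr ⟨hxy, h₃, ?_⟩⟩
    refine (hG.branch_or_branch hxy.symm v).resolve_right fun h₄ => ?_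
    exact hG.not_branch_of_branch hxy.symm h₂ (h₄.extend hu.symm h₁.ne.symm)

/-- The leaves beyond the directed edge `u → v`. -/
def beyondLeaves (G : SimpleGraph V) (L : Finset V) (u v : V) : Finset V :=
  L.filter (Branch G u v)

theorem mem_beyondLeaves {L : Finset V} : x ∈ beyondLeaves G L u v ↔ x ∈ L ∧ Branch G u v x := by
  simp [beyondLeaves]

/-- The linear words on the leaves beyond `u → v` in which the leaves beyond each further
edge are contiguous. -/
def planarWords [DecidableEq V] (G : SimpleGraph V) (L : Finset V) (u v : V) : Set (List V) :=
  {l | l.Nodup ∧ l.toFinset = beyondLeaves G L u v ∧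
    ∀ x y, Beyond G u v x y → IsSegment l (beyondLeaves G L x y)}

theorem finite_planarWords [DecidableEq V] [Finite V] (G : SimpleGraph V) (L : Finset V)
    (u v : V) : (planarWords G L u v).Finite := by
  have : Fintype V := Fintype.ofFinite V
  have : Finite {l : List V | l.Nodup} := inferInstanceAs (Finite {l : List V // l.Nodup})
  exact (Set.toFinite {l : List V | l.Nodup}).subset fun l hl => hl.1

theorem SimpleGraph.IsTree.beyondLeaves_subset {L : Finset V} (hG : G.IsTree)
    (h : Beyond G u v x y) : beyondLeaves G L x y ⊆ beyondLeaves G L u v := by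
  classical
  obtain ⟨hxy, ⟨p, -, hp⟩, h₂⟩ := h
  intro z hz
  rw [mem_beyondLeaves] at hz ⊢
  obtain ⟨hzL, q, -, hq⟩ := hz
  refine ⟨hzL, ?_⟩
  have hu : u ∉ q.support := fun hu => hG.not_branch_of_branch hxy.symm h₂
    (Branch.of_walk (q.takeUntil u hu) fun hx => hq (q.support_takeUntil_subset_support hu hx))
  refine Branch.of_walk ((p.concat hxy).append q) ?_
  rw [SimpleGraph.Walk.mem_support_append_iff, SimpleGraph.Walk.support_concat]
  simpa [hp, hu] using h₂.ne

theorem SimpleGraph.IsTree.disjoint_beyondLeaves {L : Finset V} (hG : G.IsTree)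
    (ha : G.Adj v a) (hb : G.Adj v b) (hab : a ≠ b) :
    Disjoint (beyondLeaves G L v a) (beyondLeaves G L v b) := by
  rw [Finset.disjoint_left]
  intro x h₁ h₂
  rw [mem_beyondLeaves] at h₁ h₂
  exact hab (hG.branch_unique ha hb h₁.2 h₂.2)

variable [DecidableEq V] {L : Finset V}

theorem SimpleGraph.IsTree.beyondLeaves_eq_union (hG : G.IsTree) (hu : G.Adj u v)
    (ha : G.Adj v a) (hb : G.Adj v b) (hau : a ≠ u) (hbu : b ≠ u)
    (hN : ∀ w, G.Adj v w → w ≠ u → w = a ∨ w = b) (hv : v ∉ L) :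
    beyondLeaves G L u v = beyondLeaves G L v a ∪ beyondLeaves G L v b := by
  ext x
  simp only [mem_beyondLeaves, Finset.mem_union]
  constructor
  · rintro ⟨hx, h⟩
    obtain ⟨w, hw, hwu, h'⟩ := h.exists_next (fun e => hv (e ▸ hx))
    rcases hN w hw hwu with rfl | rfl
    · exact Or.inl ⟨hx, h'⟩
    · exact Or.inr ⟨hx, h'⟩
  · rintro (⟨hx, h⟩ | ⟨hx, h⟩)
    · exact ⟨hx, hG.branch_of_next hu ha hau h⟩
    · exact ⟨hx, hG.branch_of_next hu hb hbu h⟩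

theorem SimpleGraph.IsTree.append_mem_planarWords (hG : G.IsTree) (hu : G.Adj u v)
    (ha : G.Adj v a) (hb : G.Adj v b) (hau : a ≠ u) (hbu : b ≠ u) (hab : a ≠ b)
    (hN : ∀ w, G.Adj v w → w ≠ u → w = a ∨ w = b) (hv : v ∉ L) {p q : List V}
    (hp : p.toFinset = beyondLeaves G L v a) (hq : q.toFinset = beyondLeaves G L v b) :
    p ++ q ∈ planarWords G L u v ↔ p ∈ planarWords G L v a ∧ q ∈ planarWords G L v b := by
  have hU := hG.beyondLeaves_eq_union hu ha hb hau hbu hN hv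
  have hd : p.Disjoint q := by
    have := hG.disjoint_beyondLeaves (L := L) ha hb hab
    rwa [← hp, ← hq, List.disjoint_toFinset_iff_disjoint] at this
  constructor
  · rintro ⟨hn, -, h⟩
    have hn' := List.nodup_append.1 hn
    refine ⟨⟨hn'.1, hp, fun x y hxy => ?_⟩, ⟨hn'.2.1, hq, fun x y hxy => ?_⟩⟩
    · exact (h x y (hG.beyond_of_next hu ha hau hxy)).left_of_append hd
        (hp ▸ hG.beyondLeaves_subset hxy)
    · exact (h x y (hG.beyond_of_next hu hb hbu hxy)).right_of_append hd
        (hq ▸ hG.beyondLeaves_subset hxy)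
  · rintro ⟨⟨hpn, -, hp'⟩, ⟨hqn, -, hq'⟩⟩
    refine ⟨List.Nodup.append hpn hqn hd, by rw [List.toFinset_append, hp, hq, hU],
      fun x y hxy => ?_⟩
    obtain ⟨w, hw, hwu, h⟩ := hG.exists_next_of_beyond hu hxy
    rcases hN w hw hwu with rfl | rfl
    · refine IsSegment.append_right ?_ q
      rcases h with ⟨rfl, rfl⟩ | h
      · exact ⟨p, List.infix_rfl, hp⟩
      · exact hp' x y h
    · refine IsSegment.append_left ?_ p
      rcases h with ⟨rfl, rfl⟩ | h
      · exact ⟨q, List.infix_rfl, hq⟩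
      · exact hq' x y h

theorem SimpleGraph.IsTree.planarWords_eq_union (hG : G.IsTree) (hu : G.Adj u v)
    (ha : G.Adj v a) (hb : G.Adj v b) (hau : a ≠ u) (hbu : b ≠ u) (hab : a ≠ b)
    (hN : ∀ w, G.Adj v w → w ≠ u → w = a ∨ w = b) (hv : v ∉ L) :
    planarWords G L u v =
      Set.image2 (· ++ ·) (planarWords G L v a) (planarWords G L v b) ∪
      Set.image2 (· ++ ·) (planarWords G L v b) (planarWords G L v a) := by
  have hN' : ∀ w, G.Adj v w → w ≠ u → w = b ∨ w = a := fun w h₁ h₂ => (hN w h₁ h₂).symm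
  ext l
  constructor
  · intro hl
    obtain ⟨p, q, hp, hq, rfl | rfl⟩ := exists_append_of_isSegment hl.1
      (hG.disjoint_beyondLeaves ha hb hab)
      (hl.2.1.trans (hG.beyondLeaves_eq_union hu ha hb hau hbu hN hv))
      (hl.2.2 v a (beyond_next hu ha hau)) (hl.2.2 v b (beyond_next hu hb hbu))
    · obtain ⟨h₁, h₂⟩ := (hG.append_mem_planarWords hu ha hb hau hbu hab hN hv hp hq).1 hl
      exact Or.inl ⟨p, h₁, q, h₂, rfl⟩
    · obtain ⟨h₁, h₂⟩ := (hG.append_mem_planarWords hu hb ha hbu hau hab.symm hN' hv hq hp).1 hl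
      exact Or.inr ⟨q, h₁, p, h₂, rfl⟩
  · rintro (⟨p, hp, q, hq, rfl⟩ | ⟨q, hq, p, hp, rfl⟩)
    · exact (hG.append_mem_planarWords hu ha hb hau hbu hab hN hv hp.2.1 hq.2.1).2 ⟨hp, hq⟩
    · exact (hG.append_mem_planarWords hu hb ha hbu hau hab.symm hN' hv hq.2.1 hp.2.1).2 ⟨hq, hp⟩

theorem length_of_mem_planarWords {l : List V} (hl : l ∈ planarWords G L u v) :
    l.length = (beyondLeaves G L u v).card := by
  rw [← hl.2.1, List.toFinset_card_of_nodup hl.1]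

theorem ncard_image2_append_planarWords (u v x y : V) :
    (Set.image2 (· ++ ·) (planarWords G L u v) (planarWords G L x y)).ncard =
      (planarWords G L u v).ncard * (planarWords G L x y).ncard := by
  rw [← Set.image_prod, Set.InjOn.ncard_image, Set.ncard_prod]
  rintro ⟨p, q⟩ ⟨hp, -⟩ ⟨p', q'⟩ ⟨hp', -⟩ h
  have := List.append_inj h
    ((length_of_mem_planarWords hp).trans (length_of_mem_planarWords hp').symm)
  exact Prod.ext this.1 this.2

theorem SimpleGraph.IsTree.ncard_planarWords_node [Finite V] (hG : G.IsTree) (hu : G.Adj u v)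
    (ha : G.Adj v a) (hb : G.Adj v b) (hau : a ≠ u) (hbu : b ≠ u) (hab : a ≠ b)
    (hN : ∀ w, G.Adj v w → w ≠ u → w = a ∨ w = b) (hv : v ∉ L)
    (hne : (beyondLeaves G L v a).Nonempty) (hne' : (beyondLeaves G L v b).Nonempty) :
    (planarWords G L u v).ncard =
      2 * ((planarWords G L v a).ncard * (planarWords G L v b).ncard) := by
  have hf : ∀ c d, (Set.image2 (· ++ ·) (planarWords G L v c) (planarWords G L v d)).Finite :=
    fun c d => (finite_planarWords ..).image2 _ (finite_planarWords ..)
  rw [hG.planarWords_eq_union hu ha hb hau hbu hab hN hv,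
    Set.ncard_union_eq ?_ (hf a b) (hf b a),
    ncard_image2_append_planarWords, ncard_image2_append_planarWords]
  · ring
  · rw [Set.disjoint_left]
    rintro _ ⟨p, hp, q, hq, rfl⟩ ⟨q', hq', p', hp', h⟩
    have hd := Finset.disjoint_left.1 (hG.disjoint_beyondLeaves (L := L) ha hb hab)
    rw [← hp.2.1] at hne hd
    rw [← hq'.2.1] at hne' hd
    cases p with
    | nil => simp at hne
    | cons c p =>
      cases q' with
      | nil => simp at hne'
      | cons c' q' =>
        have : c' = c := (List.cons.inj h).1
        subst this
        exact hd (a := c') (by simp) (by simp)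

theorem planarWords_of_leaf (hu : G.Adj u v) (hv : v ∈ L) (hN : ∀ w, G.Adj v w → w = u) :
    beyondLeaves G L u v = {v} ∧ planarWords G L u v = {[v]} := by
  have hx : ∀ x, Branch G u v x → x = v := by
    intro x hx
    by_contra hne
    obtain ⟨w, hw, hwu, -⟩ := hx.exists_next hne
    exact hwu (hN w hw)
  have hB : beyondLeaves G L u v = {v} := by
    ext x
    rw [mem_beyondLeaves, Finset.mem_singleton]
    refine ⟨fun h => hx x h.2, ?_⟩
    rintro rfl
    exact ⟨hv, Branch.self hu.ne'⟩
  refine ⟨hB, ?_⟩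
  ext l
  rw [Set.mem_singleton_iff]
  constructor
  · intro hl
    have hlen := length_of_mem_planarWords hl
    rw [hB, Finset.card_singleton, List.length_eq_one_iff] at hlen
    obtain ⟨c, rfl⟩ := hlen
    have := hl.2.1
    rw [hB] at this
    simpa using this
  · rintro rfl
    refine ⟨by simp, by simp [hB], ?_⟩
    rintro x y ⟨hxy, h₁, h₂⟩
    obtain rfl := hx x h₁
    exact absurd (hN y hxy).symm h₂.ne

theorem IsTrivalentTree.two_mul_ncard_planarWords [Fintype V] (hT : IsTrivalentTree G L)
    (hu : G.Adj u v) :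
    2 * (planarWords G L u v).ncard = 2 ^ (beyondLeaves G L u v).card := by
  obtain ⟨hG, hL, hI⟩ := hT
  induction hn : {x | Branch G u v x}.ncard using Nat.strong_induction_on generalizing u v with
  | _ n ih =>
  by_cases hv : v ∈ L
  · have hdeg := (hL v).1 hv
    have hN : ∀ w, G.Adj v w → w = u := by
      intro w hw
      rw [← SimpleGraph.card_neighborFinset_eq_degree, Finset.card_eq_one] at hdeg
      obtain ⟨c, hc⟩ := hdeg
      have h₁ := (SimpleGraph.mem_neighborFinset G v w).2 hw
      have h₂ := (SimpleGraph.mem_neighborFinset G v u).2 hu.symm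
      rw [hc, Finset.mem_singleton] at h₁ h₂
      rw [h₁, h₂]
    obtain ⟨h₁, h₂⟩ := planarWords_of_leaf hu hv hN
    simp [h₁, h₂]
  · have hdeg := hI v hv
    have hu' := (SimpleGraph.mem_neighborFinset G v u).2 hu.symm
    rw [← SimpleGraph.card_neighborFinset_eq_degree] at hdeg
    have h2 : ((G.neighborFinset v).erase u).card = 2 := by
      rw [Finset.card_erase_of_mem hu', hdeg]
    obtain ⟨a, b, hab, he⟩ := Finset.card_eq_two.1 h2
    have hmem : ∀ w, w ≠ u ∧ G.Adj v w ↔ w = a ∨ w = b := by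
      intro w
      rw [← SimpleGraph.mem_neighborFinset, ← Finset.mem_erase, he]
      simp
    obtain ⟨hau, ha⟩ := (hmem a).2 (Or.inl rfl)
    obtain ⟨hbu, hb⟩ := (hmem b).2 (Or.inr rfl)
    have hN : ∀ w, G.Adj v w → w ≠ u → w = a ∨ w = b := fun w h₁ h₂ => (hmem w).1 ⟨h₂, h₁⟩
    have hlt : ∀ {w}, G.Adj v w → w ≠ u →
        {x | Branch G v w x}.ncard < {x | Branch G u v x}.ncard := by
      intro w hw hwu
      refine Set.ncard_lt_ncard ⟨fun x hx => hG.branch_of_next hu hw hwu hx, fun h => ?_⟩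
      exact (h (Branch.self hu.ne')).ne rfl
    have iha := ih _ (hn ▸ hlt ha hau) ha rfl
    have ihb := ih _ (hn ▸ hlt hb hbu) hb rfl
    have hpos : ∀ {m : ℕ} {s : Finset V}, 2 * m = 2 ^ s.card → s.Nonempty := by
      rintro m s h
      by_contra hs
      rw [Finset.not_nonempty_iff_eq_empty.1 hs] at h
      simp at h
    rw [hG.ncard_planarWords_node hu ha hb hau hbu hab hN hv (hpos iha) (hpos ihb),
      hG.beyondLeaves_eq_union hu ha hb hau hbu hN hv,
      Finset.card_union_of_disjoint (hG.disjoint_beyondLeaves ha hb hab), pow_add, ← iha, ← ihb]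
    ring

theorem reverse_mem_planarWords {l : List V} (hl : l ∈ planarWords G L u v) :
    l.reverse ∈ planarWords G L u v :=
  ⟨List.nodup_reverse.2 hl.1, by rw [List.toFinset_reverse, hl.2.1],
    fun x y h => (hl.2.2 x y h).reverse⟩

theorem SimpleGraph.IsTree.leafSide_eq [Fintype V] (hG : G.IsTree) (h : G.Adj u v) :
    leafSide G L u v = beyondLeaves G L v u := by
  ext x
  rw [mem_beyondLeaves, leafSide, Finset.mem_filter, hG.reachable_deleteEdges_iff_branch h]

theorem SimpleGraph.IsTree.beyondLeaves_swap (hG : G.IsTree) (h : G.Adj u v) :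
    beyondLeaves G L v u = L \ beyondLeaves G L u v := by
  ext x
  simp only [Finset.mem_sdiff, mem_beyondLeaves, not_and]
  exact ⟨fun ⟨h₁, h₂⟩ => ⟨h₁, fun _ => hG.not_branch_of_branch h.symm h₂⟩,
    fun ⟨h₁, h₂⟩ => ⟨h₁, (hG.branch_or_branch h x).resolve_left (h₂ h₁)⟩⟩

theorem SimpleGraph.IsTree.beyondLeaves_of_leaf (hG : G.IsTree) (hu : G.Adj u v)
    (hN : ∀ w, G.Adj u w → w = v) : beyondLeaves G L u v = L.erase u := by
  ext x
  rw [mem_beyondLeaves, Finset.mem_erase]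
  exact ⟨fun h => ⟨h.2.ne, h.1⟩, fun h => ⟨h.2, hG.branch_of_leaf hu hN h.1⟩⟩

theorem SimpleGraph.IsTree.compatTree_cons_iff [Fintype V] (hG : G.IsTree) (hu : G.Adj u v)
    (hN : ∀ w, G.Adj u w → w = v) {l : List V} (hl : (u :: l).Nodup)
    (hL : (u :: l).toFinset = L) :
    CompatTree G L (u :: l) ↔ l ∈ planarWords G L u v := by
  have hl' := List.nodup_cons.1 hl
  have hlL : l.toFinset = beyondLeaves G L u v := by
    rw [hG.beyondLeaves_of_leaf hu hN, ← hL, List.toFinset_cons,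
      Finset.erase_insert (by simpa using hl'.1)]
  have hnot : ∀ {x y}, G.Adj x y → Branch G y x u → u ∉ beyondLeaves G L x y :=
    fun hxy h h' => hG.not_branch_of_branch hxy.symm h (mem_beyondLeaves.1 h').2
  constructor
  · intro h
    refine ⟨hl'.2, hlL, fun x y hxy => ?_⟩
    rw [← isArc_cons_iff hl'.1 (hnot hxy.1 hxy.2.2), ← hG.leafSide_eq hxy.1.symm]
    exact h y x hxy.1.symm
  · intro h
    have key : ∀ {x y}, G.Adj x y → Branch G y x u → IsArc (u :: l) (beyondLeaves G L x y) := by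
      intro x y hxy hb
      rw [isArc_cons_iff hl'.1 (hnot hxy hb)]
      by_cases hx : x = u
      · subst hx
        rw [hN y hxy]
        exact ⟨l, List.infix_rfl, hlL⟩
      · exact h.2.2 x y ⟨hxy, hG.branch_of_leaf hu hN hx, hb⟩
    intro x y hxy
    rw [hG.leafSide_eq hxy]
    rcases hG.branch_or_branch hxy u with hb | hb
    · exact key hxy.symm hb
    · rw [hG.beyondLeaves_swap hxy, ← hL]
      rw [← hL] at key
      exact (key hxy hb).compl hl

theorem CompatTree.of_dihEquiv [Fintype V] {l l' : List V} (h : DihEquiv l l')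
    (hl : CompatTree G L l) : CompatTree G L l' :=
  fun x y hxy => (hl x y hxy).of_dihEquiv h

theorem compatQ_mk_iff [Fintype V] (l : {l : List V // l.Nodup ∧ l.toFinset = L}) :
    CompatQ G L (Quotient.mk (wordSetoid _) l) ↔ CompatTree G L l.1 :=
  ⟨fun ⟨_, h, hl'⟩ => hl'.of_dihEquiv (Quotient.exact h), fun h => ⟨l, rfl, h⟩⟩

instance finite_colorOrderingOn [Finite V] : Finite (ColorOrderingOn L) := by
  have : Fintype V := Fintype.ofFinite V
  have : Finite {l : List V // l.Nodup ∧ l.toFinset = L} :=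
    Finite.of_injective (β := {l : List V // l.Nodup}) (fun l => ⟨l.1, l.2.1⟩)
      fun a b h => Subtype.ext (congrArg (fun c => c.1) h)
  exact Quotient.finite _

theorem IsTrivalentTree.card_compatQ [Fintype V] [Fintype (ColorOrderingOn L)]
    (hT : IsTrivalentTree G L) (hn : 3 ≤ L.card) :
    (Finset.univ.filter (CompatQ G L)).card = 2 ^ (L.card - 3) := by
  have hG := hT.1
  obtain ⟨r, hr⟩ : L.Nonempty := Finset.card_pos.1 (by omega)
  have hdeg := (hT.2.1 r).1 hr
  rw [← SimpleGraph.card_neighborFinset_eq_degree, Finset.card_eq_one] at hdeg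
  obtain ⟨s, hs⟩ := hdeg
  have hmem : ∀ w, G.Adj r w ↔ w = s := fun w => by
    rw [← SimpleGraph.mem_neighborFinset, hs, Finset.mem_singleton]
  have hrs : G.Adj r s := (hmem s).2 rfl
  have hN : ∀ w, G.Adj r w → w = s := fun w => (hmem w).1
  have hB := hG.beyondLeaves_of_leaf (L := L) hrs hN
  have hBc : (beyondLeaves G L r s).card = L.card - 1 := by rw [hB, Finset.card_erase_of_mem hr]
  have hcount := hT.two_mul_ncard_planarWords hrs
  have hcons : ∀ {l : List V}, l ∈ planarWords G L r s →
      (r :: l).Nodup ∧ (r :: l).toFinset = L := by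
    intro l hl
    have h := hl.2.1
    rw [hB] at h
    refine ⟨List.nodup_cons.2 ⟨?_, hl.1⟩, by rw [List.toFinset_cons, h, Finset.insert_erase hr]⟩
    rw [← List.mem_toFinset, h]
    exact Finset.notMem_erase r L
  have : Fintype (planarWords G L r s) := (finite_planarWords G L r s).fintype
  let f : planarWords G L r s → ColorOrderingOn L :=
    fun l => Quotient.mk (wordSetoid _) ⟨r :: l.1, hcons l.2⟩
  have hf : ∀ l l', f l = f l' ↔ l'.1 = l.1 ∨ l'.1 = l.1.reverse := fun l l' =>
    Quotient.eq.trans (cons_dihEquiv_cons_iff (List.nodup_cons.1 (hcons l.2).1).1)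
  have hmaps : Set.MapsTo f (Finset.univ : Finset (planarWords G L r s))
      (Finset.univ.filter (CompatQ G L)) := by
    intro l _
    simp only [Finset.coe_filter, Finset.mem_univ, true_and, Set.mem_ofPred_eq]
    exact (compatQ_mk_iff _).2
      ((hG.compatTree_cons_iff hrs hN (hcons l.2).1 (hcons l.2).2).2 l.2)
  have hfib : ∀ w ∈ Finset.univ.filter (CompatQ G L),
      (Finset.univ.filter fun l => f l = w).card = 2 := by
    intro w hw
    obtain ⟨l, rfl⟩ := Quotient.exists_rep w
    have hcl := (compatQ_mk_iff l).1 (Finset.mem_filter.1 hw).2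
    have hrl : r ∈ l.1 := by rw [← List.mem_toFinset, l.2.2]; exact hr
    obtain ⟨p, q, hpq⟩ := List.append_of_mem hrl
    have hrot : l.1 ~r (r :: (q ++ p)) := by
      rw [hpq]
      exact isRotated_iff_exists_append.2 ⟨p, r :: q, rfl, rfl⟩
    have hm : q ++ p ∈ planarWords G L r s :=
      (hG.compatTree_cons_iff hrs hN (hrot.nodup_iff.1 l.2.1)
        ((List.toFinset_eq_of_perm _ _ hrot.perm).symm.trans l.2.2)).1
        (hcl.of_dihEquiv (Or.inl hrot))
    have hfm : Quotient.mk (wordSetoid _) l = f ⟨q ++ p, hm⟩ :=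
      Quotient.sound (s := wordSetoid _) (Or.inl hrot)
    have hset : (Finset.univ.filter fun l' => f l' = Quotient.mk (wordSetoid _) l) =
        {⟨q ++ p, hm⟩, ⟨(q ++ p).reverse, reverse_mem_planarWords hm⟩} := by
      ext l'
      rw [Finset.mem_filter, hfm, eq_comm (a := f l'), hf]
      simp [Subtype.ext_iff]
    rw [hset, Finset.card_pair]
    intro h
    refine reverse_ne_self_of_nodup hm.1 ?_ (congrArg Subtype.val h).symm
    rw [length_of_mem_planarWords hm, hBc]
    omega
  have hsum := Finset.card_eq_sum_card_fiberwise hmaps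
  rw [Finset.sum_const_nat hfib, Finset.card_univ, ← Set.toFinset_card,
    ← Set.ncard_eq_toFinset_card'] at hsum
  rw [hsum, hBc, show L.card - 1 = L.card - 3 + 2 by omega, pow_add] at hcount
  omega

end Trees

/-- Dolan–Goddard double counting: for any finite collection `𝒮` of trivalent trees with
leaf set `L` (`|L| = n ≥ 3`), summing over all (2,n) color orderings `σ` on `L`, the number
of trees of `𝒮` compatible with `σ` totals `2 ^ (n-3) · |𝒮|`; more generally, for any
weight `F`, `∑_σ ∑_{T ∈ 𝒮 compatible with σ} F T = 2 ^ (n-3) · ∑_{T ∈ 𝒮} F T`. -/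
theorem sum_over_color_orderings {V : Type*} [Fintype V] [DecidableEq V]
    (L : Finset V) (hn : 3 ≤ L.card)
    (𝒮 : Finset (SimpleGraph V)) (h𝒮 : ∀ T ∈ 𝒮, IsTrivalentTree T L)
    (F : SimpleGraph V → ℝ) :
    (∑ᶠ w : ColorOrderingOn L, ∑ T ∈ 𝒮, if CompatQ T L w then (1 : ℕ) else 0) =
        2 ^ (L.card - 3) * 𝒮.card ∧
    (∑ᶠ w : ColorOrderingOn L, ∑ T ∈ 𝒮, if CompatQ T L w then F T else 0) =
        2 ^ (L.card - 3) * ∑ T ∈ 𝒮, F T := by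
  have : Fintype (ColorOrderingOn L) := Fintype.ofFinite _
  have key : ∀ T ∈ 𝒮, (Finset.univ.filter (CompatQ T L)).card = 2 ^ (L.card - 3) :=
    fun T hT => (h𝒮 T hT).card_compatQ hn
  rw [finsum_eq_sum_of_fintype, finsum_eq_sum_of_fintype]
  constructor
  · rw [Finset.sum_comm, Finset.sum_congr rfl fun T hT => by
      rw [← Finset.card_filter, key T hT], Finset.sum_const, smul_eq_mul, mul_comm]
  · rw [Finset.sum_comm, Finset.mul_sum]
    refine Finset.sum_congr rfl fun T hT => ?_
    rw [← Finset.sum_filter, Finset.sum_const, key T hT, nsmul_eq_mul]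
    push_cast
    rfl

end
end

section
/- Let T be a finite tree with leaf set L (the vertices of degree 1), |L| = n ≥ 2, let f : E(T) → ℝ assign a length to each edge, and for leaves a, b let d(a,b) be the sum of f over the edges of the unique path in T from a to b. Let s : L × L → ℝ be symmetric with s(a,a) = 0 for every a and Σ_{b∈L} s(a,b) = 0 for every a. For each edge e of T, whose deletion induces the partition L = L_e ⊔ R_e of the leaves, set q_e = Σ_{a∈L_e} Σ_{b∈R_e} s(a,b). Then Σ_{{a,b}} s(a,b)·d(a,b) = Σ_{e∈E(T)} q_e·f(e), where the left-hand sum is over unordered pairs of distinct leaves; moreover q_e = 0 for every edge e incident to a leaf, so only edges joining two internal vertices contribute to the right-hand side. -/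
open scoped Classical

noncomputable section

theorem mem_leafSide {V : Type*} [Fintype V] [DecidableEq V] {G : SimpleGraph V} {L : Finset V}
    {u v x : V} :
    x ∈ leafSide G L u v ↔ x ∈ L ∧ (G.deleteEdges {s(u, v)}).Reachable u x := by
  simp [leafSide]

/-- The start and the end of a trail lie on the two sides of any edge it traverses. -/
theorem SimpleGraph.Walk.IsTrail.reachable_deleteEdges_of_mem_darts {V : Type*}
    {G : SimpleGraph V} {a b : V} {p : G.Walk a b} (hp : p.IsTrail) {e : G.Dart}
    (he : e ∈ p.darts) :
    (G.deleteEdges {s(e.fst, e.snd)}).Reachable e.fst a ∧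
      (G.deleteEdges {s(e.fst, e.snd)}).Reachable e.snd b := by
  induction p with
  | nil => simp at he
  | @cons a w b h p ih =>
    rw [SimpleGraph.Walk.isTrail_cons] at hp
    rw [SimpleGraph.Walk.darts_cons, List.mem_cons] at he
    rcases he with rfl | he
    · refine ⟨SimpleGraph.Reachable.refl _, ?_⟩
      exact SimpleGraph.reachable_deleteEdges_iff_exists_walk.mpr ⟨p, hp.2⟩
    · obtain ⟨hu, hv⟩ := ih hp.1 he
      refine ⟨hu.trans (SimpleGraph.Adj.reachable ?_), hv⟩
      rw [SimpleGraph.deleteEdges_adj]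
      refine ⟨h.symm, fun hmem => hp.2 ?_⟩
      rw [Set.mem_singleton_iff] at hmem
      rw [Sym2.eq_swap, hmem]
      exact List.mem_map_of_mem he

/-- In a forest, a path traverses the edge `{u, v}` from `u` to `v` exactly when it starts on the
`u`-side and ends on the `v`-side of that edge. -/
theorem SimpleGraph.IsAcyclic.mem_darts_iff {V : Type*} {G : SimpleGraph V} (hG : G.IsAcyclic)
    {a b : V} {p : G.Walk a b} (hp : p.IsPath) (e : G.Dart) :
    e ∈ p.darts ↔ (G.deleteEdges {s(e.fst, e.snd)}).Reachable e.fst a ∧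
      (G.deleteEdges {s(e.fst, e.snd)}).Reachable e.snd b := by
  refine ⟨hp.isTrail.reachable_deleteEdges_of_mem_darts, fun ⟨ha, hb⟩ => ?_⟩
  have hbridge : ¬ (G.deleteEdges {s(e.fst, e.snd)}).Reachable e.fst e.snd :=
    SimpleGraph.isAcyclic_iff_forall_adj_isBridge.mp hG e.adj
  have hmem : s(e.fst, e.snd) ∈ p.edges := by
    by_contra hnot
    exact hbridge ((ha.trans
      (SimpleGraph.reachable_deleteEdges_iff_exists_walk.mpr ⟨p, hnot⟩)).trans hb.symm)
  obtain ⟨e', he', heq⟩ := List.mem_map.mp hmem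
  rcases (SimpleGraph.dart_edge_eq_iff e' e).mp heq with rfl | rfl
  · exact he'
  · have hrev := (hp.isTrail.reachable_deleteEdges_of_mem_darts he').1
    rw [show s(e.symm.fst, e.symm.snd) = s(e.fst, e.snd) from Sym2.eq_swap] at hrev
    exact absurd (ha.trans hrev.symm) hbridge

theorem SimpleGraph.IsAcyclic.sum_map_edges {V : Type*} [Fintype V] [DecidableEq V]
    {G : SimpleGraph V}
    (hG : G.IsAcyclic) {a b : V} {p : G.Walk a b} (hp : p.IsPath) {M : Type*} [AddCommMonoid M]
    (f : Sym2 V → M) :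
    (p.edges.map f).sum = ∑ u : V, ∑ v : V,
      if G.Adj u v ∧ (G.deleteEdges {s(u, v)}).Reachable u a ∧
        (G.deleteEdges {s(u, v)}).Reachable v b then f s(u, v) else 0 := by
  have hnodup : (p.darts.map SimpleGraph.Dart.toProd).Nodup :=
    (SimpleGraph.Walk.darts_nodup_of_support_nodup hp.support_nodup).map
      SimpleGraph.Dart.toProd_injective
  have hlist : p.edges.map f =
      (p.darts.map SimpleGraph.Dart.toProd).map fun x => f s(x.1, x.2) := by
    simp only [SimpleGraph.Walk.edges, List.map_map]
    rfl
  have hmem : ∀ x : V × V, x ∈ p.darts.map SimpleGraph.Dart.toProd ↔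
      G.Adj x.1 x.2 ∧ (G.deleteEdges {s(x.1, x.2)}).Reachable x.1 a ∧
        (G.deleteEdges {s(x.1, x.2)}).Reachable x.2 b := by
    intro x
    rw [List.mem_map]
    constructor
    · rintro ⟨e, he, rfl⟩
      exact ⟨e.adj, (hG.mem_darts_iff hp e).mp he⟩
    · rintro ⟨hadj, h⟩
      exact ⟨⟨x, hadj⟩, (hG.mem_darts_iff hp ⟨x, hadj⟩).mpr h, rfl⟩
  rw [hlist, ← List.sum_toFinset _ hnodup, ← Fintype.sum_prod_type', ← Finset.sum_filter]
  exact Finset.sum_congr (by ext x; simp only [List.mem_toFinset, hmem, Finset.mem_filter,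
    Finset.mem_univ, true_and]) fun _ _ => rfl

theorem reachable_deleteEdges_iff_eq_of_degree_eq_one {V : Type*} {G : SimpleGraph V} {u v : V}
    [Fintype (G.neighborSet u)] (hdeg : G.degree u = 1) (huv : G.Adj u v) (x : V) :
    (G.deleteEdges {s(u, v)}).Reachable u x ↔ u = x := by
  refine ⟨?_, fun h => h ▸ SimpleGraph.Reachable.refl _⟩
  rintro ⟨p⟩
  cases p with
  | nil => rfl
  | @cons _ w _ h p =>
    rw [SimpleGraph.deleteEdges_adj] at h
    have := (SimpleGraph.degree_eq_one_iff_existsUnique_adj.mp hdeg).unique h.1 huv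
    exact absurd (by simp [this]) h.2

theorem sum_leafSide_eq_zero_of_degree_eq_one {V : Type*} [Fintype V] [DecidableEq V]
    {G : SimpleGraph V} (hG : G.Connected) {L : Finset V} {kin : V → V → ℝ}
    (hdiag : ∀ a : V, kin a a = 0) (hrow : ∀ a ∈ L, ∑ b ∈ L, kin a b = 0)
    {u v : V} (hdeg : G.degree u = 1) (hu : u ∈ L) (huv : G.Adj u v) :
    ∑ x ∈ leafSide G L u v, ∑ y ∈ leafSide G L v u, kin x y = 0 := by
  have hside : leafSide G L u v = {u} := by
    ext x
    rw [mem_leafSide, reachable_deleteEdges_iff_eq_of_degree_eq_one hdeg huv, Finset.mem_singleton]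
    exact ⟨fun h => h.2.symm, fun h => ⟨h ▸ hu, h.symm⟩⟩
  rw [hside, Finset.sum_singleton, ← hrow u hu]
  refine Finset.sum_subset (fun x hx => (mem_leafSide.mp hx).1) fun x hx hnot => ?_
  suffices hux : u = x by rw [← hux, hdiag]
  by_contra hne
  refine hnot (mem_leafSide.mpr ⟨hx, ?_⟩)
  obtain ⟨p, hp⟩ := (hG u x).exists_isPath
  cases p with
  | nil => exact absurd rfl hne
  | @cons _ w _ h p =>
    obtain rfl := (SimpleGraph.degree_eq_one_iff_existsUnique_adj.mp hdeg).unique h huv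
    rw [Sym2.eq_swap]
    exact SimpleGraph.reachable_deleteEdges_iff_exists_walk.mpr
      ⟨p, (SimpleGraph.Walk.isTrail_cons _ _ |>.mp hp.isTrail).2⟩

/-- Let `G` be a finite tree with leaf set `L` (`|L| ≥ 2`), let `f` assign a length to each
edge, and let `d a b` be the length of the unique path between two leaves.  Let `kin` be
symmetric kinematic data on the leaves with vanishing diagonal and vanishing row sums, and
for an edge `e = {u,v}` let `q e = ∑_{a ∈ L_e} ∑_{b ∈ R_e} kin a b`, summed over the two
blocks of the induced leaf partition.  Then `∑_{{a,b}} kin a b · d a b = ∑_e q e · f e`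
(here both sides are written as sums over ordered pairs, so each side is doubled), and
moreover `q e = 0` for every edge `e` incident to a leaf, so only internal edges
contribute. -/
theorem tree_metric_kinematic_identity {V : Type*} [Fintype V] [DecidableEq V]
    (G : SimpleGraph V) (hG : G.IsTree)
    (L : Finset V) (hL : ∀ v : V, v ∈ L ↔ G.degree v = 1) (hn : 2 ≤ L.card)
    (f : Sym2 V → ℝ)
    (d : V → V → ℝ)
    (hd : ∀ (a b : V) (p : G.Walk a b), p.IsPath → d a b = (p.edges.map f).sum)
    (kin : V → V → ℝ)
    (hsymm : ∀ a b : V, kin a b = kin b a)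
    (hdiag : ∀ a : V, kin a a = 0)
    (hrow : ∀ a ∈ L, ∑ b ∈ L, kin a b = 0) :
    ((∑ a ∈ L, ∑ b ∈ L, kin a b * d a b) =
      ∑ u : V, ∑ v : V,
        if G.Adj u v then
          (∑ x ∈ leafSide G L u v, ∑ y ∈ leafSide G L v u, kin x y) * f s(u, v)
        else 0) ∧
    (∀ u v : V, G.Adj u v → (u ∈ L ∨ v ∈ L) →
      (∑ x ∈ leafSide G L u v, ∑ y ∈ leafSide G L v u, kin x y) = 0) := by
  refine ⟨?_, fun u v huv hleaf => ?_⟩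
  · have hdist : ∀ a ∈ L, ∀ b ∈ L, d a b = ∑ u : V, ∑ v : V,
        if G.Adj u v ∧ a ∈ leafSide G L u v ∧ b ∈ leafSide G L v u then f s(u, v) else 0 := by
      intro a ha b hb
      obtain ⟨p, hp⟩ := (hG.connected a b).exists_isPath
      rw [hd a b p hp, hG.isAcyclic.sum_map_edges hp]
      refine Finset.sum_congr rfl fun u _ => Finset.sum_congr rfl fun v _ => if_congr ?_ rfl rfl
      rw [mem_leafSide, mem_leafSide, Sym2.eq_swap (a := v)]
      tauto
    calc ∑ a ∈ L, ∑ b ∈ L, kin a b * d a b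
        = ∑ a ∈ L, ∑ b ∈ L, ∑ u : V, ∑ v : V, kin a b *
          if G.Adj u v ∧ a ∈ leafSide G L u v ∧ b ∈ leafSide G L v u then f s(u, v) else 0 := by
          refine Finset.sum_congr rfl fun a ha => Finset.sum_congr rfl fun b hb => ?_
          simp only [hdist a ha b hb, Finset.mul_sum]
      _ = ∑ u : V, ∑ v : V, ∑ a ∈ L, ∑ b ∈ L, kin a b *
          if G.Adj u v ∧ a ∈ leafSide G L u v ∧ b ∈ leafSide G L v u then f s(u, v) else 0 := by
          simp only [Finset.sum_comm (s := L) (t := Finset.univ)]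
      _ = _ := by
          refine Finset.sum_congr rfl fun u _ => Finset.sum_congr rfl fun v _ => ?_
          by_cases huv : G.Adj u v
          · have hL_inter : ∀ u v : V, L ∩ leafSide G L u v = leafSide G L u v := fun u v =>
              Finset.inter_eq_right.mpr (Finset.filter_subset _ _)
            simp only [huv, true_and, if_true, Finset.sum_mul, ite_and, mul_ite, mul_zero]
            rw [← hL_inter u v, ← hL_inter v u, ← Finset.sum_ite_mem]
            refine Finset.sum_congr rfl fun a _ => ?_
            rw [← Finset.sum_ite_mem, hL_inter, hL_inter]
            split_ifs <;> simp
          · simp [huv]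
  · rcases hleaf with hu | hv
    · exact sum_leafSide_eq_zero_of_degree_eq_one hG.connected hdiag hrow ((hL u).mp hu) hu huv
    · rw [Finset.sum_comm]
      rw [← sum_leafSide_eq_zero_of_degree_eq_one hG.connected hdiag hrow ((hL v).mp hv) hv
        huv.symm]
      exact Finset.sum_congr rfl fun y _ => Finset.sum_congr rfl fun x _ => hsymm x y

end
end

section
/- Let k ≥ 4 and n ≥ k+2, and let Σ be a (k,n) pre-GCO on {1,…,n}. If for every j ∈ [n] the k-decreasing projection π_{(j)}(Σ) is a (k−1,n−1) pseudo-GCO, then Σ is a (k,n) pseudo-GCO. In particular, combined with the forward direction, for k ≥ 4 a (k,n) pre-GCO has all of its k-preserving projections pseudo-GCOs if and only if all of its k-decreasing projections are pseudo-GCOs. -/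
/-- A `(k, S.card)` pre-GCO on the label set `S`, given by representatives: to every
`(k-2)`-element subset `I ⊆ S` it assigns a cyclic word on `S \ I` (a representative of
a `(2, S.card - k + 2)` color ordering).  Values of `σ` on other subsets are irrelevant. -/
def IsPreGCO (k : ℕ) (S : Finset ℕ) (σ : Finset ℕ → List ℕ) : Prop :=
  ∀ I : Finset ℕ, I ⊆ S → I.card = k - 2 →
    (σ I).Nodup ∧ (σ I).toFinset = S \ I

/-- The recursive pseudo-GCO condition on a `(k, S.card)` pre-GCO (given by
representatives).  For `S.card = k + 2` it says that the pre-GCO is the descendant of a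
`(2, k+2)` color ordering (represented by `base`); for `S.card > k + 2` it requires all
`k`-preserving projections (delete the component at subsets containing `i`, and delete
the label `i` from the remaining components) to be pseudo-GCOs. -/
def IsPseudoGCO (k : ℕ) (S : Finset ℕ) (σ : Finset ℕ → List ℕ) : Prop :=
  if S.card ≤ k + 2 then
    ∃ base : List ℕ, base.Nodup ∧ base.toFinset = S ∧
      ∀ I : Finset ℕ, I ⊆ S → I.card = k - 2 →
        DihEquiv (σ I) (base.filter (fun x => x ∉ I))
  else
    ∀ i ∈ S, IsPseudoGCO k (S.erase i) (fun I => (σ I).filter (fun x => x ≠ i))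
termination_by S.card
decreasing_by exact Finset.card_erase_lt_of_mem ‹_›

/-- `y` lies strictly between `x` and `z` with respect to the positions `g`. -/
def Between {α : Type*} (g : α → ℤ) (x y z : α) : Prop :=
  (g x < g y ∧ g y < g z) ∨ (g z < g y ∧ g y < g x)

/-- The strict order with `a` before `b` recovered from a betweenness relation `B`. -/
def BetweenLT {α : Type*} (B : α → α → α → Prop) (a b x y : α) : Prop :=
  (x = a ∧ y ≠ a ∧ ¬ B y a b) ∨ (y = a ∧ x ≠ a ∧ B x a b) ∨
  (x ≠ a ∧ y ≠ a ∧ ((¬ B x a b ∧ ¬ B y a b ∧ B a x y) ∨ (B x a b ∧ B y a b ∧ B x y a) ∨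
    (B x a b ∧ ¬ B y a b)))

theorem betweenLT_iff_of_side {α : Type*} {B : α → α → α → Prop} {a b : α} {V : Set α} {g : α → ℤ}
    (hg : V.InjOn g) (ha : a ∈ V)
    (hB : ∀ x ∈ V, ∀ y ∈ V, ∀ z ∈ V, B x y z ↔ Between g x y z)
    (hside : ∀ x ∈ V, x ≠ a → (B x a b ↔ g x < g a))
    {x y : α} (hx : x ∈ V) (hy : y ∈ V) : BetweenLT B a b x y ↔ g x < g y := by
  have h1 := hside x hx
  have h2 := hside y hy
  have h3 := hB a ha x hx y hy
  have h4 := hB x hx y hy a ha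
  have h5 : g x = g a → x = a := fun h => hg hx ha h
  have h6 : g y = g a → y = a := fun h => hg hy ha h
  unfold BetweenLT Between at *
  by_cases hxa : x = a
  · subst hxa; by_cases hya : y = x
    · subst hya; simp
    · simp [hya, h2 hya]; grind
  · by_cases hya : y = a
    · subst hya; simp [hxa, h1 hxa]
    · simp only [hxa, hya, h3, h4, h1 hxa, h2 hya]; grind

/-- Four-point consistent betweenness: on three points and `a`, `BetweenLT` is a linear order. -/
theorem exists_betweenLT_iff {α : Type*} {B : α → α → α → Prop} {U : Set α}
    (hB : ∀ p ∈ U, ∀ q ∈ U, ∀ r ∈ U, ∀ s ∈ U, ∃ g : α → ℤ, Set.InjOn g {p, q, r, s} ∧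
      ∀ x ∈ ({p, q, r, s} : Set α), ∀ y ∈ ({p, q, r, s} : Set α), ∀ z ∈ ({p, q, r, s} : Set α),
        B x y z ↔ Between g x y z)
    {a b : α} (ha : a ∈ U) (hb : b ∈ U) (hab : a ≠ b) {p q r : α} (hp : p ∈ U) (hq : q ∈ U)
    (hr : r ∈ U) :
    ∃ g : α → ℤ, Set.InjOn g {a, p, q, r} ∧
      (∀ x ∈ ({a, p, q, r} : Set α), ∀ y ∈ ({a, p, q, r} : Set α), ∀ z ∈ ({a, p, q, r} : Set α),
        B x y z ↔ Between g x y z) ∧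
      ∀ x ∈ ({a, p, q, r} : Set α), ∀ y ∈ ({a, p, q, r} : Set α),
        BetweenLT B a b x y ↔ g x < g y := by
  have key : ∀ x ∈ U, ∀ y ∈ U, x ≠ a → y ≠ a → (B x a y ↔ ¬ (B x a b ↔ B y a b)) := by
    intro x hx y hy hxa hya
    obtain ⟨g, hg, h⟩ := hB a ha b hb x hx y hy
    have m1 : a ∈ ({a, b, x, y} : Set α) := by simp
    have m2 : b ∈ ({a, b, x, y} : Set α) := by simp
    have m3 : x ∈ ({a, b, x, y} : Set α) := by simp
    have m4 : y ∈ ({a, b, x, y} : Set α) := by simp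
    rw [h x m3 a m1 y m4, h x m3 a m1 b m2, h y m4 a m1 b m2]
    have e1 := mt (hg m1 m2) hab
    have e2 := mt (hg m3 m1) hxa
    have e3 := mt (hg m4 m1) hya
    unfold Between
    rcases lt_or_gt_of_ne e1 with e1 | e1 <;> rcases lt_or_gt_of_ne e2 with e2 | e2 <;>
      rcases lt_or_gt_of_ne e3 with e3 | e3 <;> simp [e1, e2, e3, e1.not_gt, e2.not_gt, e3.not_gt]
  obtain ⟨g, hg, h⟩ := hB a ha p hp q hq r hr
  have m1 : a ∈ ({a, p, q, r} : Set α) := by simp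
  have hsub : ∀ x ∈ ({a, p, q, r} : Set α), x ∈ U := by
    rintro x (rfl | rfl | rfl | rfl) <;> assumption
  have hor : (∀ x ∈ ({a, p, q, r} : Set α), x ≠ a → (B x a b ↔ g x < g a)) ∨
      (∀ x ∈ ({a, p, q, r} : Set α), x ≠ a → (B x a b ↔ g a < g x)) := by
    by_contra! hcon
    obtain ⟨⟨x, hx, hxa, h1⟩, y, hy, hya, h2⟩ := hcon
    have e := key x (hsub x hx) y (hsub y hy) hxa hya
    rw [h x hx a m1 y hy] at e
    have e2 := mt (hg hx m1) hxa
    have e3 := mt (hg hy m1) hya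
    unfold Between at e
    rcases lt_or_gt_of_ne e2 with e2 | e2 <;> rcases lt_or_gt_of_ne e3 with e3 | e3 <;>
      simp [e2, e3, e2.not_gt, e3.not_gt, e2.not_ge, e3.not_ge] at h1 h2 e <;> tauto
  rcases hor with hor | hor
  · exact ⟨g, hg, h, fun x hx y hy => betweenLT_iff_of_side hg m1 h hor hx hy⟩
  · have hg' : Set.InjOn (fun x => - g x) {a, p, q, r} :=
      fun x hx y hy e => hg hx hy (by simpa using e)
    have h' : ∀ x ∈ ({a, p, q, r} : Set α), ∀ y ∈ ({a, p, q, r} : Set α),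
        ∀ z ∈ ({a, p, q, r} : Set α), B x y z ↔ Between (fun x => - g x) x y z := by
      intro x hx y hy z hz
      rw [h x hx y hy z hz]; unfold Between; simp only [neg_lt_neg_iff]; tauto
    exact ⟨_, hg', h', fun x hx y hy =>
      betweenLT_iff_of_side hg' m1 h' (by simpa using hor) hx hy⟩

/-- A betweenness relation that is linear on every four points is linear. -/
theorem exists_between_iff {α : Type*} {B : α → α → α → Prop} {U : Finset α}
    (hB : ∀ p ∈ U, ∀ q ∈ U, ∀ r ∈ U, ∀ s ∈ U, ∃ g : α → ℤ, Set.InjOn g {p, q, r, s} ∧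
      ∀ x ∈ ({p, q, r, s} : Set α), ∀ y ∈ ({p, q, r, s} : Set α), ∀ z ∈ ({p, q, r, s} : Set α),
        B x y z ↔ Between g x y z) (hU : 1 < U.card) :
    ∃ g : α → ℤ, Set.InjOn g U ∧ ∀ x ∈ U, ∀ y ∈ U, ∀ z ∈ U, B x y z ↔ Between g x y z := by
  classical
  obtain ⟨a, ha, b, hb, hab⟩ := Finset.one_lt_card.mp hU
  have H := fun p (hp : p ∈ U) q (hq : q ∈ U) r (hr : r ∈ U) =>
    exists_betweenLT_iff (U := (U : Set α)) (B := B) (by simpa using hB) ha hb hab hp hq hr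
  set R : α → α → Prop := BetweenLT B a b
  have irrefl : ∀ x ∈ U, ¬ R x x := by
    intro x hx
    obtain ⟨g, -, -, h⟩ := H x hx x hx x hx
    rw [h x (by simp) x (by simp)]; simp
  have trans : ∀ x ∈ U, ∀ y ∈ U, ∀ z ∈ U, R x y → R y z → R x z := by
    intro x hx y hy z hz
    obtain ⟨g, -, -, h⟩ := H x hx y hy z hz
    rw [h x (by simp) y (by simp), h y (by simp) z (by simp), h x (by simp) z (by simp)]
    exact lt_trans
  have total : ∀ x ∈ U, ∀ y ∈ U, x ≠ y → R x y ∨ R y x := by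
    intro x hx y hy hxy
    obtain ⟨g, hg, -, h⟩ := H x hx y hy y hy
    rw [h x (by simp) y (by simp), h y (by simp) x (by simp)]
    exact lt_or_gt_of_ne (fun e => hxy (hg (by simp) (by simp) e))
  have mono : ∀ x ∈ U, ∀ y ∈ U, R x y →
      (U.filter (fun z => R z x)).card < (U.filter (fun z => R z y)).card := by
    intro x hx y hy hxy
    apply Finset.card_lt_card
    rw [Finset.ssubset_iff_of_subset]
    · exact ⟨x, by simp [hx, hxy], by simp [irrefl x hx]⟩
    · intro z hz
      simp only [Finset.mem_filter] at hz ⊢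
      exact ⟨hz.1, trans z hz.1 x hx y hy hz.2 hxy⟩
  have inj : Set.InjOn (fun x => ((U.filter (fun z => R z x)).card : ℤ)) U := by
    intro x hx y hy e
    by_contra hne
    have e' : (U.filter (fun z => R z x)).card = (U.filter (fun z => R z y)).card :=
      Nat.cast_injective e
    rcases total x hx y hy hne with h | h
    · exact absurd (mono x hx y hy h) (by omega)
    · exact absurd (mono y hy x hx h) (by omega)
  have iff : ∀ x ∈ U, ∀ y ∈ U, (((U.filter (fun z => R z x)).card : ℤ) <
      (U.filter (fun z => R z y)).card ↔ R x y) := by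
    intro x hx y hy
    refine ⟨fun h => ?_, fun h => by exact_mod_cast mono x hx y hy h⟩
    by_contra hn
    have hne : x ≠ y := by rintro rfl; exact lt_irrefl _ h
    have := mono y hy x hx ((total x hx y hy hne).resolve_left hn)
    omega
  refine ⟨_, inj, fun x hx y hy z hz => ?_⟩
  obtain ⟨g, -, h1, h2⟩ := H x hx y hy z hz
  unfold Between
  rw [iff x hx y hy, iff y hy z hz, iff z hz y hy, iff y hy x hx,
    h1 x (by simp) y (by simp) z (by simp),
    h2 x (by simp) y (by simp), h2 y (by simp) z (by simp), h2 z (by simp) y (by simp),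
    h2 y (by simp) x (by simp)]
  rfl

/-- Betweenness determines a linear order up to reversal. -/
theorem lt_iff_or_gt_iff_of_between {α : Type*} {V : Set α} {g h : α → ℤ} (hg : V.InjOn g)
    (hh : V.InjOn h)
    (H : ∀ x ∈ V, ∀ y ∈ V, ∀ z ∈ V, Between g x y z ↔ Between h x y z) :
    (∀ x ∈ V, ∀ y ∈ V, g x < g y ↔ h x < h y) ∨ (∀ x ∈ V, ∀ y ∈ V, g x < g y ↔ h y < h x) := by
  by_cases htriv : ∀ x ∈ V, ∀ y ∈ V, x = y
  · left
    intro x hx y hy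
    obtain rfl := htriv x hx y hy
    simp
  push Not at htriv
  obtain ⟨a, ha, b, hb, hab⟩ := htriv
  have aux : ∀ f : α → ℤ, V.InjOn f → f a < f b →
      (∀ x ∈ V, ∀ y ∈ V, ∀ z ∈ V, Between g x y z ↔ Between f x y z) →
      ∀ x ∈ V, ∀ y ∈ V, BetweenLT (Between g) a b x y ↔ f x < f y := by
    intro f hf hlt hB x hx y hy
    refine betweenLT_iff_of_side hf ha hB ?_ hx hy
    intro x hx hxa
    rw [hB x hx a ha b hb]
    unfold Between
    have := hlt.not_gt
    tauto
  have auxneg : ∀ f : α → ℤ, V.InjOn f → f b < f a →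
      (∀ x ∈ V, ∀ y ∈ V, ∀ z ∈ V, Between g x y z ↔ Between f x y z) →
      ∀ x ∈ V, ∀ y ∈ V, BetweenLT (Between g) a b x y ↔ f y < f x := by
    intro f hf hlt hB x hx y hy
    have := aux (fun x => - f x) (fun x hx y hy e => hf hx hy (by simpa using e))
      (by simpa using hlt)
      (by
        intro x hx y hy z hz
        rw [hB x hx y hy z hz]; unfold Between; simp only [neg_lt_neg_iff]; tauto) x hx y hy
    simpa using this
  rcases lt_or_gt_of_ne (mt (hg ha hb) hab) with h1 | h1 <;>
    rcases lt_or_gt_of_ne (mt (hh ha hb) hab) with h2 | h2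
  · exact .inl fun x hx y hy =>
      (aux g hg h1 (by simp) x hx y hy).symm.trans (aux h hh h2 H x hx y hy)
  · exact .inr fun x hx y hy =>
      (aux g hg h1 (by simp) x hx y hy).symm.trans (auxneg h hh h2 H x hx y hy)
  · exact .inr fun x hx y hy =>
      (auxneg g hg h1 (by simp) y hy x hx).symm.trans (aux h hh h2 H y hy x hx)
  · exact .inl fun x hx y hy =>
      (auxneg g hg h1 (by simp) y hy x hx).symm.trans (auxneg h hh h2 H y hy x hx)

theorem exists_lt_iff_of_between {α : Type*} [DecidableEq α] {U : Finset α} (hU : 5 ≤ U.card)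
    {g : α → α → ℤ} (hg : ∀ j ∈ U, Set.InjOn (g j) (U.erase j))
    (H : ∀ i ∈ U, ∀ j ∈ U, ∀ x ∈ U.erase i, ∀ y ∈ U.erase i, ∀ z ∈ U.erase i,
      x ∈ U.erase j → y ∈ U.erase j → z ∈ U.erase j →
      (Between (g i) x y z ↔ Between (g j) x y z)) :
    ∃ r : α → ℤ, Set.InjOn r U ∧ ∀ j ∈ U,
      (∀ x ∈ U.erase j, ∀ y ∈ U.erase j, r x < r y ↔ g j x < g j y) ∨
      (∀ x ∈ U.erase j, ∀ y ∈ U.erase j, r x < r y ↔ g j y < g j x) := by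
  set B : α → α → α → Prop := fun x y z =>
    ∃ j ∈ U, x ∈ U.erase j ∧ y ∈ U.erase j ∧ z ∈ U.erase j ∧ Between (g j) x y z
  have hBj : ∀ j ∈ U, ∀ x ∈ U.erase j, ∀ y ∈ U.erase j, ∀ z ∈ U.erase j,
      (B x y z ↔ Between (g j) x y z) := by
    intro j hj x hx y hy z hz
    refine ⟨?_, fun h => ⟨j, hj, hx, hy, hz, h⟩⟩
    rintro ⟨i, hi, hx', hy', hz', h⟩
    exact (H i hi j hj x hx' y hy' z hz' hx hy hz).1 h
  have h4 : ∀ p ∈ U, ∀ q ∈ U, ∀ r ∈ U, ∀ s ∈ U, ∃ f : α → ℤ, Set.InjOn f {p, q, r, s} ∧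
      ∀ x ∈ ({p, q, r, s} : Set α), ∀ y ∈ ({p, q, r, s} : Set α),
        ∀ z ∈ ({p, q, r, s} : Set α), B x y z ↔ Between f x y z := by
    intro p hp q hq r hr s hs
    obtain ⟨j, hj, hjn⟩ : ∃ j ∈ U, j ∉ ({p, q, r, s} : Finset α) :=
      Finset.exists_mem_notMem_of_card_lt_card (Finset.card_le_four.trans_lt (by omega))
    have hsub : ∀ x ∈ ({p, q, r, s} : Set α), x ∈ U.erase j := by
      intro x hx
      refine Finset.mem_erase.2 ⟨?_, ?_⟩
      · rintro rfl
        exact hjn (by simpa using hx)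
      · rcases hx with rfl | rfl | rfl | rfl <;> assumption
    exact ⟨g j, (hg j hj).mono hsub, fun x hx y hy z hz =>
      hBj j hj x (hsub x hx) y (hsub y hy) z (hsub z hz)⟩
  obtain ⟨r, hr, hrB⟩ := exists_between_iff h4 (by omega)
  refine ⟨r, hr, fun j hj => ?_⟩
  have hsub : ∀ x ∈ U.erase j, x ∈ U := fun x hx => Finset.mem_of_mem_erase hx
  exact lt_iff_or_gt_iff_of_between (V := (U.erase j : Set α)) (hr.mono (by simp))
    (hg j hj) fun x hx y hy z hz =>
      (hrB x (hsub x hx) y (hsub y hy) z (hsub z hz)).symm.trans (hBj j hj x hx y hy z hz)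

theorem pairwise_idxOf_lt {α : Type*} [DecidableEq α] {l : List α} (hl : l.Nodup) :
    l.Pairwise fun x y => (l.idxOf x : ℤ) < l.idxOf y := by
  rw [List.pairwise_iff_getElem]
  intro i j hi hj hij
  rw [hl.idxOf_getElem, hl.idxOf_getElem]
  exact_mod_cast hij

theorem lt_iff_lt_of_pairwise {α : Type*} {l : List α} {g h : α → ℤ}
    (hg : l.Pairwise fun x y => g x < g y) (hh : l.Pairwise fun x y => h x < h y)
    {x y : α} (hx : x ∈ l) (hy : y ∈ l) : g x < g y ↔ h x < h y := by
  refine List.Pairwise.forall_of_forall_of_flip (R := fun x y => g x < g y ↔ h x < h y)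
    (fun x _ => by simp) ((hg.and hh).imp ?_) ((hg.and hh).imp ?_) hx hy
  · rintro a b ⟨h1, h2⟩; simp [h1, h2]
  · rintro a b ⟨h1, h2⟩; simp [flip, h1.not_gt, h2.not_gt]

theorem between_iff_of_filter_eq_or_reverse {α : Type*} {p : α → Bool} {l l' : List α}
    {g h : α → ℤ}
    (hg : l.Pairwise fun x y => g x < g y) (hh : l'.Pairwise fun x y => h x < h y)
    (hf : l.filter p = l'.filter p ∨ l.filter p = (l'.filter p).reverse) {x y z : α}
    (hx : x ∈ l.filter p) (hy : y ∈ l.filter p) (hz : z ∈ l.filter p) :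
    Between g x y z ↔ Between h x y z := by
  have hg' := hg.filter p
  have hh' := hh.filter p
  unfold Between
  rcases hf with hf | hf
  · rw [← hf] at hh'
    rw [lt_iff_lt_of_pairwise hg' hh' hx hy, lt_iff_lt_of_pairwise hg' hh' hy hz,
      lt_iff_lt_of_pairwise hg' hh' hz hy, lt_iff_lt_of_pairwise hg' hh' hy hx]
  · have hh'' : (l.filter p).Pairwise fun x y => -h x < -h y := by
      rw [hf, List.pairwise_reverse]; simpa using hh'
    rw [lt_iff_lt_of_pairwise hg' hh'' hx hy, lt_iff_lt_of_pairwise hg' hh'' hy hz,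
      lt_iff_lt_of_pairwise hg' hh'' hz hy, lt_iff_lt_of_pairwise hg' hh'' hy hx]
    simp only [neg_lt_neg_iff]
    tauto

theorem eq_of_perm_of_lt_iff {α : Type*} {l l' : List α} {g h : α → ℤ}
    (hg : l.Pairwise fun x y => g x < g y) (hh : l'.Pairwise fun x y => h x < h y)
    (hp : l.Perm l') (H : ∀ x ∈ l, ∀ y ∈ l, g x < g y ↔ h x < h y) : l = l' := by
  refine List.Perm.eq_of_pairwise (le := fun x y => h x < h y) ?_ ?_ hh hp
  · intro a b _ _ h1 h2
    exact absurd h1 h2.not_gt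
  · exact hg.imp_of_mem fun hx hy hlt => (H _ hx _ hy).1 hlt

theorem eq_reverse_of_perm_of_lt_iff {α : Type*} {l l' : List α} {g h : α → ℤ}
    (hg : l.Pairwise fun x y => g x < g y) (hh : l'.Pairwise fun x y => h x < h y)
    (hp : l.Perm l') (H : ∀ x ∈ l, ∀ y ∈ l, g x < g y ↔ h y < h x) : l = l'.reverse := by
  refine eq_of_perm_of_lt_iff (h := fun x => - h x) hg ?_ (hp.trans l'.reverse_perm.symm)
    (by simpa using H)
  rw [List.pairwise_reverse]
  simpa using hh

theorem exists_pairwise_lt {α : Type*} {U : Finset α} {r : α → ℤ} (hr : Set.InjOn r U) :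
    ∃ l : List α, l.Perm U.toList ∧ l.Pairwise fun x y => r x < r y := by
  refine ⟨U.toList.mergeSort fun x y => decide (r x ≤ r y), List.mergeSort_perm _ _, ?_⟩
  have hp := List.mergeSort_perm U.toList fun x y => decide (r x ≤ r y)
  have h1 := List.pairwise_mergeSort (le := fun x y => decide (r x ≤ r y))
    (by simpa using fun a b c => le_trans) (by simp [le_total]) U.toList
  have h2 : (U.toList.mergeSort fun x y => decide (r x ≤ r y)).Nodup :=
    hp.nodup_iff.2 U.nodup_toList
  refine (h1.and h2).imp_of_mem ?_
  rintro a b ha hb ⟨h, hne⟩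
  rw [hp.mem_iff, Finset.mem_toList] at ha hb
  exact lt_of_le_of_ne (by simpa using h) fun e => hne (hr ha hb e)

/-- Linear orders up to reversal on the sets `U.erase j`, agreeing on triples, can be glued. -/
theorem exists_glue_reverse {α : Type*} [DecidableEq α] {U : Finset α} (hU : 5 ≤ U.card)
    {m : α → List α} (hm : ∀ j ∈ U, (m j).Nodup ∧ (m j).toFinset = U.erase j)
    (H : ∀ i ∈ U, ∀ j ∈ U, ∀ t ⊆ U, t.card = 3 → i ∉ t → j ∉ t →
      (m i).filter (· ∈ t) = (m j).filter (· ∈ t) ∨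
      (m i).filter (· ∈ t) = ((m j).filter (· ∈ t)).reverse) :
    ∃ l : List α, l.Nodup ∧ l.toFinset = U ∧
      ∀ j ∈ U, l.filter (· ≠ j) = m j ∨ l.filter (· ≠ j) = (m j).reverse := by
  have hmem : ∀ j ∈ U, ∀ x, x ∈ m j ↔ x ∈ U.erase j := fun j hj x => by
    rw [← (hm j hj).2, List.mem_toFinset]
  obtain ⟨r, hr, hrj⟩ := exists_lt_iff_of_between (g := fun j x => ((m j).idxOf x : ℤ)) hU
    (fun j hj x hx y hy e =>
      (List.idxOf_inj ((hmem j hj x).2 hx)).1 (Nat.cast_injective e)) (by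
    intro i hi j hj x hx y hy z hz hx' hy' hz'
    by_cases hd : x ≠ y ∧ x ≠ z ∧ y ≠ z
    · have ht : ({x, y, z} : Finset α).card = 3 := Finset.card_eq_three.2
        ⟨x, y, z, hd.1, hd.2.1, hd.2.2, rfl⟩
      have hpi := pairwise_idxOf_lt (hm i hi).1
      have hpj := pairwise_idxOf_lt (hm j hj).1
      rw [← hmem i hi] at hx hy hz
      refine between_iff_of_filter_eq_or_reverse hpi hpj (H i hi j hj {x, y, z} ?_ ht ?_ ?_)
        (by simpa using hx) (by simpa using hy) (by simpa using hz)
      · simp only [Finset.mem_erase] at *; grind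
      · simp only [hmem i hi, Finset.mem_erase] at *; grind
      · simp only [Finset.mem_erase] at *; grind
    · unfold Between; grind)
  obtain ⟨l, hl, hs⟩ := exists_pairwise_lt hr
  have hnd : l.Nodup := hl.nodup_iff.2 U.nodup_toList
  have hlU : ∀ x, x ∈ l ↔ x ∈ U := fun x => by rw [hl.mem_iff, Finset.mem_toList]
  refine ⟨l, hnd, by ext x; simp [hlU], fun j hj => ?_⟩
  have hperm : (l.filter (· ≠ j)).Perm (m j) := by
    rw [List.perm_ext_iff_of_nodup (hnd.filter _) (hm j hj).1]
    intro x; simp [hlU, hmem j hj, and_comm]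
  have hpj := pairwise_idxOf_lt (hm j hj).1
  have hin : ∀ x ∈ l.filter (· ≠ j), x ∈ U.erase j := fun x hx =>
    (hmem j hj x).1 (hperm.mem_iff.1 hx)
  exact (hrj j hj).imp
    (fun h => eq_of_perm_of_lt_iff (hs.filter _) hpj hperm
      fun x hx y hy => h x (hin x hx) y (hin y hy))
    (fun h => eq_reverse_of_perm_of_lt_iff (hs.filter _) hpj hperm
      fun x hx y hy => h x (hin x hx) y (hin y hy))

theorem List.IsRotated.filter {α : Type*} {l l' : List α} (h : l ~r l') (p : α → Bool) :
    l.filter p ~r l'.filter p := by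
  obtain ⟨n, rfl⟩ := h
  rw [List.rotate_eq_drop_append_take_mod, List.filter_append]
  refine .trans ?_ List.isRotated_append
  rw [← List.filter_append, List.take_append_drop]

theorem List.IsRotated.eq_of_cons {α : Type*} {o : α} {l l' : List α} (hl : (o :: l).Nodup)
    (h : (o :: l) ~r (o :: l')) : l = l' := by
  obtain ⟨n, hn, e⟩ := List.isRotated_iff_mod.1 h
  rcases Nat.lt_or_ge n (o :: l).length with hlt | hge
  · have h0 : ((o :: l).rotate n)[0]? = (o :: l')[0]? := by rw [e]
    rw [List.getElem?_rotate (by simp)] at h0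
    have : n = 0 := by
      rw [Nat.zero_add, Nat.mod_eq_of_lt hlt] at h0
      have h1 : (o :: l)[n]? = (o :: l)[0]? := by rw [h0]; rfl
      exact (List.getElem?_inj hlt hl).1 h1
    subst this
    simpa using e
  · rw [le_antisymm hn hge, List.rotate_length] at e
    simpa using e

theorem exists_isRotated_cons {α : Type*} {o : α} {l : List α} (h : o ∈ l) :
    ∃ m, l ~r (o :: m) := by
  obtain ⟨s, t, rfl⟩ := List.append_of_mem h
  exact ⟨t ++ s, List.isRotated_append⟩

theorem DihEquiv.filter {α : Type*} {l l' : List α} (h : DihEquiv l l') (p : α → Bool) :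
    DihEquiv (l.filter p) (l'.filter p) :=
  h.imp (fun h => h.filter p) (fun h => by rw [← List.filter_reverse]; exact h.filter p)

theorem dihEquiv_cons_iff {α : Type*} {o : α} {l l' : List α} (hl : (o :: l).Nodup) :
    DihEquiv (o :: l) (o :: l') ↔ l = l' ∨ l = l'.reverse := by
  have hrev : (o :: l).reverse ~r (o :: l.reverse) := by
    rw [List.reverse_cons]; exact List.IsRotated.cons_append_singleton.symm
  constructor
  · rintro (h | h)
    · exact .inl (h.eq_of_cons hl)
    · refine .inr ?_
      rw [← (hrev.symm.trans h).eq_of_cons (hrev.nodup_iff.1 (List.nodup_reverse.2 hl)),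
        List.reverse_reverse]
  · rintro (rfl | rfl)
    · exact dihEquiv_refl _
    · exact .inr (by simpa using hrev)

/-- Dihedral orders on the sets `T.erase j`, agreeing on all quadruples, can be glued. -/
theorem exists_glue_dihEquiv {α : Type*} [DecidableEq α] {T : Finset α} (hT : 6 ≤ T.card)
    {τ : α → List α} (hτ : ∀ j ∈ T, (τ j).Nodup ∧ (τ j).toFinset = T.erase j)
    (H : ∀ i ∈ T, ∀ j ∈ T, ∀ Q ⊆ T, Q.card = 4 → i ∉ Q → j ∉ Q →
      DihEquiv ((τ i).filter (· ∈ Q)) ((τ j).filter (· ∈ Q))) :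
    ∃ l : List α, l.Nodup ∧ l.toFinset = T ∧ ∀ Q ⊆ T, Q.card = 4 → ∀ j ∈ T, j ∉ Q →
      DihEquiv ((τ j).filter (· ∈ Q)) (l.filter (· ∈ Q)) := by
  obtain ⟨o, ho⟩ : T.Nonempty := Finset.card_pos.1 (by omega)
  have hmem : ∀ j ∈ T, ∀ x, x ∈ τ j ↔ x ∈ T.erase j := fun j hj x => by
    rw [← (hτ j hj).2, List.mem_toFinset]
  have hex : ∀ j, ∃ m, j ∈ T.erase o → τ j ~r (o :: m) := by
    intro j
    by_cases hj : j ∈ T.erase o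
    · obtain ⟨m, hm⟩ := exists_isRotated_cons (o := o) (l := τ j) (by
        rw [hmem j (Finset.mem_of_mem_erase hj)]
        simp only [Finset.mem_erase] at hj ⊢
        exact ⟨hj.1.symm, ho⟩)
      exact ⟨m, fun _ => hm⟩
    · exact ⟨[], fun h => absurd h hj⟩
  choose m hm using hex
  have hcons : ∀ j ∈ T.erase o, (o :: m j).Nodup := fun j hj =>
    (hm j hj).nodup_iff.1 (hτ j (Finset.mem_of_mem_erase hj)).1
  obtain ⟨l, hl, hlU, hlm⟩ := exists_glue_reverse (U := T.erase o) (m := m)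
    (by rw [Finset.card_erase_of_mem ho]; omega)
    (by
      intro j hj
      have hn := List.nodup_cons.1 (hcons j hj)
      refine ⟨hn.2, ?_⟩
      ext x
      have h1 := (hm j hj).mem_iff (a := x)
      rw [hmem j (Finset.mem_of_mem_erase hj)] at h1
      simp only [List.mem_toFinset, Finset.mem_erase, List.mem_cons] at *
      grind)
    (by
      intro i hi j hj t ht hcard hit hjt
      have hot : o ∉ t := fun h => by simpa using ht h
      have h1 := H i (Finset.mem_of_mem_erase hi) j (Finset.mem_of_mem_erase hj) (insert o t)
        (Finset.insert_subset ho (ht.trans (Finset.erase_subset _ _)))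
        (by rw [Finset.card_insert_of_notMem hot, hcard])
        (by simp [hit, (Finset.mem_erase.1 hi).1]) (by simp [hjt, (Finset.mem_erase.1 hj).1])
      have key : ∀ j ∈ T.erase o,
          (o :: m j).filter (· ∈ insert o t) = o :: (m j).filter (· ∈ t) := by
        intro j hj
        rw [List.filter_cons_of_pos (by simp)]
        congr 1
        apply List.filter_congr
        intro x hx
        have : x ≠ o := by rintro rfl; exact (List.nodup_cons.1 (hcons j hj)).1 hx
        simp [this]
      have h2 := dihEquiv_trans (dihEquiv_symm (Or.inl ((hm i hi).filter (· ∈ insert o t))))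
        (dihEquiv_trans h1 (Or.inl ((hm j hj).filter (· ∈ insert o t))))
      rw [key i hi, key j hj] at h2
      refine (dihEquiv_cons_iff ?_).1 h2
      rw [← key i hi]
      exact (hcons i hi).filter _)
  have hol : o ∉ l := by
    rw [← List.mem_toFinset, hlU]; simp
  have main : ∀ Q ⊆ T, ∀ j ∈ T.erase o, j ∉ Q →
      DihEquiv ((τ j).filter (· ∈ Q)) ((o :: l).filter (· ∈ Q)) := by
    intro Q hQ j hj hjQ
    have hoj : o ≠ j := (Finset.mem_erase.1 hj).1.symm
    have h1 : DihEquiv (o :: m j) (o :: l.filter (· ≠ j)) :=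
      dihEquiv_symm ((dihEquiv_cons_iff
        (List.nodup_cons.2 ⟨fun h => hol (List.mem_of_mem_filter h), hl.filter _⟩)).2 (hlm j hj))
    have h2 := (dihEquiv_trans (Or.inl (hm j hj)) h1).filter (· ∈ Q)
    have h3 : (o :: l.filter (· ≠ j)) = (o :: l).filter (· ≠ j) := by
      rw [List.filter_cons_of_pos (by simpa using hoj)]
    rw [h3, List.filter_filter] at h2
    convert h2 using 2
    ext x
    by_cases hx : x ∈ Q
    · have : x ≠ j := by rintro rfl; exact hjQ hx
      simp [this]
    · simp [hx]
  refine ⟨o :: l, List.nodup_cons.2 ⟨hol, hl⟩, ?_, ?_⟩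
  · rw [List.toFinset_cons, hlU, Finset.insert_erase ho]
  · intro Q hQ hcard j hj hjQ
    by_cases hjo : j = o
    · obtain ⟨i, hi, hin⟩ : ∃ i ∈ T, i ∉ insert o Q :=
        Finset.exists_mem_notMem_of_card_lt_card
          ((Finset.card_insert_le _ _).trans_lt (by omega))
      rw [Finset.mem_insert, not_or] at hin
      exact dihEquiv_trans (H j hj i hi Q hQ hcard hjQ hin.2)
        (main Q hQ i (Finset.mem_erase.2 ⟨hin.1, hi⟩) hin.2)
    · exact main Q hQ j (Finset.mem_erase.2 ⟨hjo, hj⟩) hjQ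

/-- Unrolled form of the recursion: only the restrictions to `k + 2` labels matter. -/
theorem isPseudoGCO_iff {k : ℕ} {S : Finset ℕ} {σ : Finset ℕ → List ℕ} (hS : k + 2 ≤ S.card)
    (hσ : ∀ I ⊆ S, I.card = k - 2 → ∀ x ∈ σ I, x ∈ S) :
    IsPseudoGCO k S σ ↔ ∀ T ⊆ S, T.card = k + 2 → ∃ base : List ℕ, base.Nodup ∧
      base.toFinset = T ∧ ∀ I ⊆ T, I.card = k - 2 →
        DihEquiv ((σ I).filter (· ∈ T)) (base.filter (· ∉ I)) := by
  obtain ⟨d, hd⟩ := Nat.exists_eq_add_of_le hS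
  induction d generalizing S σ with
  | zero =>
    rw [IsPseudoGCO, if_pos (by omega)]
    have hfil : ∀ I ⊆ S, I.card = k - 2 → (σ I).filter (· ∈ S) = σ I := fun I hI hc =>
      List.filter_eq_self.2 fun x hx => by simpa using hσ I hI hc x hx
    constructor
    · rintro ⟨base, h1, h2, h3⟩ T hT hc
      obtain rfl := Finset.eq_of_subset_of_card_le hT (by omega)
      exact ⟨base, h1, h2, fun I hI hIc => by rw [hfil I hI hIc]; exact h3 I hI hIc⟩
    · intro h
      obtain ⟨base, h1, h2, h3⟩ := h S subset_rfl (by omega)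
      exact ⟨base, h1, h2, fun I hI hIc => by rw [← hfil I hI hIc]; exact h3 I hI hIc⟩
  | succ d ih =>
    rw [IsPseudoGCO, if_neg (by omega)]
    have hfil : ∀ (i : ℕ) (T : Finset ℕ) (l : List ℕ), i ∉ T →
        (l.filter (fun x => x ≠ i)).filter (· ∈ T) = l.filter (· ∈ T) := by
      intro i T l hi
      rw [List.filter_filter]
      apply List.filter_congr
      intro x _
      by_cases hx : x ∈ T
      · have : x ≠ i := by rintro rfl; exact hi hx
        simp [this]
      · simp [hx]
    have ih' : ∀ i ∈ S, _ := fun i hi => ih (S := S.erase i)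
      (σ := fun I => (σ I).filter (fun x => x ≠ i))
      (by rw [Finset.card_erase_of_mem hi]; omega)
      (by
        intro I hI hc x hx
        rw [List.mem_filter] at hx
        exact Finset.mem_erase.2 ⟨by simpa using hx.2,
          hσ I (hI.trans (Finset.erase_subset _ _)) hc x hx.1⟩)
      (by rw [Finset.card_erase_of_mem hi]; omega)
    constructor
    · intro h T hT hc
      obtain ⟨i, hi, hiT⟩ : ∃ i ∈ S, i ∉ T :=
        Finset.exists_mem_notMem_of_card_lt_card (by omega)
      obtain ⟨base, h1, h2, h3⟩ := (ih' i hi).1 (h i hi) T (Finset.subset_erase.2 ⟨hT, hiT⟩) hc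
      refine ⟨base, h1, h2, fun I hI hIc => ?_⟩
      rw [← hfil i T _ hiT]
      exact h3 I hI hIc
    · intro h i hi
      refine (ih' i hi).2 fun T hT hc => ?_
      obtain ⟨hT, hiT⟩ := Finset.subset_erase.1 hT
      obtain ⟨base, h1, h2, h3⟩ := h T hT hc
      refine ⟨base, h1, h2, fun I hI hIc => ?_⟩
      rw [hfil i T _ hiT]
      exact h3 I hI hIc

/-- The labels of a decreasing projection of a pre-GCO. -/
theorem mem_erase_of_mem_insert {k : ℕ} (hk : 3 ≤ k) {S : Finset ℕ} {σ : Finset ℕ → List ℕ}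
    (hpre : IsPreGCO k S σ) {j : ℕ} (hj : j ∈ S) :
    ∀ J ⊆ S.erase j, J.card = k - 1 - 2 → ∀ x ∈ σ (insert j J), x ∈ S.erase j := by
  intro J hJ hc x hx
  obtain ⟨hJS, hjJ⟩ := Finset.subset_erase.1 hJ
  rw [← List.mem_toFinset, (hpre (insert j J) (Finset.insert_subset hj hJS)
    (by rw [Finset.card_insert_of_notMem hjJ]; omega)).2] at hx
  simp only [Finset.mem_sdiff, Finset.mem_insert, not_or, Finset.mem_erase] at hx ⊢
  exact ⟨hx.2.1, hx.1⟩

theorem filter_mem_erase {α : Type*} [DecidableEq α] {l : List α} {j : α} (h : j ∉ l)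
    (T : Finset α) : l.filter (· ∈ T.erase j) = l.filter (· ∈ T) := by
  apply List.filter_congr
  intro x hx
  have : x ≠ j := by rintro rfl; exact h hx
  simp [this]

theorem isPseudoGCO_of_decreasing {k : ℕ} (hk : 4 ≤ k) {S : Finset ℕ} (hS : k + 2 ≤ S.card)
    {σ : Finset ℕ → List ℕ} (hpre : IsPreGCO k S σ)
    (h : ∀ j ∈ S, IsPseudoGCO (k - 1) (S.erase j) (fun J => σ (insert j J))) :
    IsPseudoGCO k S σ := by
  have hmem : ∀ I ⊆ S, I.card = k - 2 → ∀ x ∈ σ I, x ∈ S \ I := fun I hI hc x hx => by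
    rw [← (hpre I hI hc).2]; simpa using hx
  rw [isPseudoGCO_iff hS fun I hI hc x hx => (Finset.mem_sdiff.1 (hmem I hI hc x hx)).1]
  intro T hT hTc
  have hex : ∀ j, ∃ τ : List ℕ, j ∈ T → τ.Nodup ∧ τ.toFinset = T.erase j ∧
      ∀ I ⊆ T, I.card = k - 2 → j ∈ I →
        DihEquiv ((σ I).filter (· ∈ T)) (τ.filter (· ∉ I)) := by
    intro j
    by_cases hj : j ∈ T
    · have hjS := hT hj
      have hc : (S.erase j).card = S.card - 1 := Finset.card_erase_of_mem hjS
      obtain ⟨τ, h1, h2, h3⟩ := (isPseudoGCO_iff (by omega)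
        (mem_erase_of_mem_insert (by omega) hpre hjS)).1 (h j hjS) (T.erase j)
        (Finset.erase_subset_erase _ hT) (by rw [Finset.card_erase_of_mem hj]; omega)
      refine ⟨τ, fun _ => ⟨h1, h2, fun I hI hIc hjI => ?_⟩⟩
      have h4 := h3 (I.erase j) (Finset.erase_subset_erase _ hI)
        (by rw [Finset.card_erase_of_mem hjI]; omega)
      have hjσ : j ∉ σ I := fun hm =>
        (Finset.mem_sdiff.1 (hmem I (hI.trans hT) hIc j hm)).2 hjI
      have hjτ : j ∉ τ := by rw [← List.mem_toFinset, h2]; simp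
      simp only [Finset.insert_erase hjI] at h4
      rw [filter_mem_erase hjσ] at h4
      convert h4 using 1
      apply List.filter_congr
      intro x hx
      have : x ≠ j := by rintro rfl; exact hjτ hx
      simp [this]
    · exact ⟨[], fun h => absurd h hj⟩
  choose τ hτ using hex
  have hcompl : ∀ I ⊆ T, ∀ l : List ℕ, (∀ x ∈ l, x ∈ T) →
      l.filter (· ∉ I) = l.filter (· ∈ T \ I) := by
    intro I _ l hl
    apply List.filter_congr
    intro x hx
    simp [hl x hx]
  have hτT : ∀ j ∈ T, ∀ x ∈ τ j, x ∈ T := fun j hj x hx => by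
    rw [← List.mem_toFinset, (hτ j hj).2.1] at hx
    exact Finset.mem_of_mem_erase hx
  have hquad : ∀ I ⊆ T, I.card = k - 2 → ∀ j ∈ I,
      DihEquiv ((σ I).filter (· ∈ T)) ((τ j).filter (· ∈ T \ I)) := by
    intro I hI hc j hj
    rw [← hcompl I hI _ (hτT j (hI hj))]
    exact (hτ j (hI hj)).2.2 I hI hc hj
  obtain ⟨l, hl, hlT, hlQ⟩ := exists_glue_dihEquiv (T := T) (τ := τ) (by omega)
    (fun j hj => ⟨(hτ j hj).1, (hτ j hj).2.1⟩) (by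
      intro i hi j hj Q hQ hQc hiQ hjQ
      have hcard : (T \ Q).card = k - 2 := by rw [Finset.card_sdiff_of_subset hQ]; omega
      have h1 := hquad (T \ Q) Finset.sdiff_subset hcard i (by simp [hi, hiQ])
      have h2 := hquad (T \ Q) Finset.sdiff_subset hcard j (by simp [hj, hjQ])
      rw [Finset.sdiff_sdiff_eq_self hQ] at h1 h2
      exact dihEquiv_trans (dihEquiv_symm h1) h2)
  refine ⟨l, hl, hlT, fun I hI hc => ?_⟩
  obtain ⟨j, hj⟩ : I.Nonempty := Finset.card_pos.1 (by omega)
  rw [hcompl I hI l fun x hx => by rw [← hlT]; simpa using hx]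
  exact dihEquiv_trans (hquad I hI hc j hj) (hlQ (T \ I) Finset.sdiff_subset
    (by rw [Finset.card_sdiff_of_subset hI]; omega) j (hI hj) (by simp [hj]))

theorem IsPseudoGCO.decreasing {k : ℕ} (hk : 3 ≤ k) {S : Finset ℕ} (hS : k + 2 ≤ S.card)
    {σ : Finset ℕ → List ℕ} (hpre : IsPreGCO k S σ) (h : IsPseudoGCO k S σ) {j : ℕ}
    (hj : j ∈ S) : IsPseudoGCO (k - 1) (S.erase j) (fun J => σ (insert j J)) := by
  have hmem : ∀ I ⊆ S, I.card = k - 2 → ∀ x ∈ σ I, x ∈ S \ I := fun I hI hc x hx => by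
    rw [← (hpre I hI hc).2]; simpa using hx
  rw [isPseudoGCO_iff hS fun I hI hc x hx => (Finset.mem_sdiff.1 (hmem I hI hc x hx)).1] at h
  rw [isPseudoGCO_iff (by rw [Finset.card_erase_of_mem hj]; omega)
    (mem_erase_of_mem_insert hk hpre hj)]
  intro T hT hTc
  obtain ⟨hTS, hjT⟩ := Finset.subset_erase.1 hT
  obtain ⟨base, h1, h2, h3⟩ := h (insert j T) (Finset.insert_subset hj hTS)
    (by rw [Finset.card_insert_of_notMem hjT]; omega)
  refine ⟨base.filter (· ≠ j), h1.filter _, ?_, fun J hJ hJc => ?_⟩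
  · rw [List.toFinset_filter, h2]
    ext x
    simp only [Finset.mem_filter, Finset.mem_insert, decide_eq_true_eq]
    constructor
    · rintro ⟨rfl | hx, hne⟩
      · exact absurd rfl hne
      · exact hx
    · exact fun hx => ⟨.inr hx, by rintro rfl; exact hjT hx⟩
  · have hjJ : j ∉ J := fun hm => hjT (hJ hm)
    have hc : (insert j J).card = k - 2 := by rw [Finset.card_insert_of_notMem hjJ]; omega
    have h4 := h3 (insert j J) (Finset.insert_subset_insert _ hJ) hc
    have hjσ : j ∉ σ (insert j J) := fun hm =>
      (Finset.mem_sdiff.1 (hmem _ (Finset.insert_subset hj (hJ.trans hTS)) hc j hm)).2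
        (Finset.mem_insert_self _ _)
    rw [← filter_mem_erase hjσ, Finset.erase_insert hjT] at h4
    convert h4 using 1
    rw [List.filter_filter]
    apply List.filter_congr
    intro x _
    simp [Bool.and_comm]

/-- Converse of the forward direction: if every `k`-decreasing projection of a `(k,n)`
pre-GCO `Σ` (with `k ≥ 4`, `n ≥ k + 2`) is a `(k-1, n-1)` pseudo-GCO, then `Σ` is a
`(k,n)` pseudo-GCO.  In particular, combined with the forward direction, for `n > k + 2`
all `k`-preserving projections of `Σ` are pseudo-GCOs if and only if all of its
`k`-decreasing projections are pseudo-GCOs. -/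
theorem pseudoGCO_of_decreasing_projections (k n : ℕ) (hk : 4 ≤ k) (hn : k + 2 ≤ n)
    (σ : Finset ℕ → List ℕ)
    (hpre : IsPreGCO k (Finset.Icc 1 n) σ) :
    ((∀ j ∈ Finset.Icc 1 n,
        IsPseudoGCO (k - 1) ((Finset.Icc 1 n).erase j) (fun J => σ (insert j J))) →
      IsPseudoGCO k (Finset.Icc 1 n) σ) ∧
    (k + 3 ≤ n →
      ((∀ i ∈ Finset.Icc 1 n,
          IsPseudoGCO k ((Finset.Icc 1 n).erase i) (fun I => (σ I).filter (fun x => x ≠ i))) ↔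
        (∀ j ∈ Finset.Icc 1 n,
          IsPseudoGCO (k - 1) ((Finset.Icc 1 n).erase j) (fun J => σ (insert j J))))) := by
  have hcard : (Finset.Icc 1 n).card = n := by simp
  have hback := isPseudoGCO_of_decreasing hk (by omega) hpre
  refine ⟨hback, fun hn' => ?_⟩
  have hunfold : IsPseudoGCO k (Finset.Icc 1 n) σ ↔ ∀ i ∈ Finset.Icc 1 n,
      IsPseudoGCO k ((Finset.Icc 1 n).erase i) (fun I => (σ I).filter (fun x => x ≠ i)) := by
    rw [IsPseudoGCO, if_neg (by omega)]
  rw [← hunfold]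
  exact ⟨fun h j hj => h.decreasing (by omega) (by omega) hpre hj, hback⟩
end
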